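/- Let d₁ ≥ d₂ ≥ 1 have the same parity. Then the space of pairs (f₁, f₂) of real homogeneous polynomials in two variables of degrees d₁ and d₂ having no common zero in ℝ² ∖ {0} has exactly d₂ + 1 connected components, and each component has the integral cohomology of a circle. -/

import Mathlib

open CategoryTheory

/-- The singular chain complex functor with coefficients in `R`. -/
noncomputable def singularChainComplexFunctor (R : Type) [CommRing R] :
    TopCat ⥤ ChainComplex (ModuleCat R) ℕ :=
  TopCat.toSSet ⋙ ((SimplicialObject.whiskering _ _).obj (ModuleCat.free R)) ⋙
    AlgebraicTopology.alternatingFaceMapComplex (ModuleCat R)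

/-- Singular cohomology of `X` with coefficients in `R`: the homology of the `R`-dual of
the singular chain complex. -/
noncomputable def singularCohomology (R : Type) [CommRing R] (X : TopCat) (n : ℕ) :
    ModuleCat R :=
  ((((linearYoneda R (ModuleCat R)).obj (ModuleCat.of R R)).mapHomologicalComplex _).obj
      ((singularChainComplexFunctor R).obj X).op).homology n

/-- The binary form of degree `d` with coefficients `a`, evaluated at `v ∈ ℝ²`. -/
def evalForm (d : ℕ) (a : Fin (d + 1) → ℝ) (v : ℝ × ℝ) : ℝ :=
  ∑ i : Fin (d + 1), a i * v.1 ^ (d - (i : ℕ)) * v.2 ^ (i : ℕ)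

/-- The space of non-resultant pairs of real binary forms of degrees `d₁` and `d₂`:
pairs of coefficient vectors whose forms have no common zero in `ℝ² ∖ {0}`. -/
def NonResultantPairs (d₁ d₂ : ℕ) : Type :=
  {fg : (Fin (d₁ + 1) → ℝ) × (Fin (d₂ + 1) → ℝ) //
    ∀ v : ℝ × ℝ, v ≠ 0 → ¬(evalForm d₁ fg.1 v = 0 ∧ evalForm d₂ fg.2 v = 0)}

instance (d₁ d₂ : ℕ) : TopologicalSpace (NonResultantPairs d₁ d₂) :=
  instTopologicalSpaceSubtype

section Cohomology

open AlgebraicTopology Opposite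

/-- The singular cochain complex functor with coefficients in `R`. -/
noncomputable def singularCochainComplexFunctor (R : Type) [CommRing R] :
    TopCatᵒᵖ ⥤ HomologicalComplex (ModuleCat R) (ComplexShape.down ℕ).symm :=
  (singularChainComplexFunctor R).op ⋙ HomologicalComplex.opFunctor _ _ ⋙
    ((linearYoneda R (ModuleCat R)).obj (ModuleCat.of R R)).mapHomologicalComplex _

/-- Homotopic maps induce homotopic maps on singular cochains. -/
noncomputable def singularCochainHomotopy (R : Type) [CommRing R] {X Y : TopCat} {f g : X ⟶ Y}
    (H : TopCat.Homotopy f g) :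
    Homotopy ((singularCochainComplexFunctor R).map f.op)
      ((singularCochainComplexFunctor R).map g.op) :=
  Functor.mapHomotopy ((linearYoneda R (ModuleCat R)).obj (ModuleCat.of R R))
    (Homotopy.op
      (H.toSSet.toSimplicialObjectHomotopy.whiskerRight (ModuleCat.free R)).toChainHomotopy)

theorem singularCochain_homologyMap_eq (R : Type) [CommRing R] {X Y : TopCat} {f g : X ⟶ Y}
    (H : TopCat.Homotopy f g) (n : ℕ) :
    HomologicalComplex.homologyMap ((singularCochainComplexFunctor R).map f.op) n =
      HomologicalComplex.homologyMap ((singularCochainComplexFunctor R).map g.op) n :=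
  (singularCochainHomotopy R H).homologyMap_eq n

/-- Homotopy equivalent spaces have isomorphic singular cohomology. -/
noncomputable def singularCohomologyIsoOfHomotopyEquiv (R : Type) [CommRing R] {X Y : Type}
    [TopologicalSpace X] [TopologicalSpace Y] (e : ContinuousMap.HomotopyEquiv X Y) (n : ℕ) :
    ((singularCochainComplexFunctor R).obj (op (TopCat.of X))).homology n ≅
      ((singularCochainComplexFunctor R).obj (op (TopCat.of Y))).homology n where
  hom := HomologicalComplex.homologyMap
    ((singularCochainComplexFunctor R).map (TopCat.ofHom e.invFun).op) n
  inv := HomologicalComplex.homologyMap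
    ((singularCochainComplexFunctor R).map (TopCat.ofHom e.toFun).op) n
  hom_inv_id := by
    rw [← HomologicalComplex.homologyMap_comp, ← Functor.map_comp, ← op_comp]
    have H : TopCat.Homotopy (TopCat.ofHom e.toFun ≫ TopCat.ofHom e.invFun) (𝟙 (TopCat.of X)) :=
      e.left_inv.some
    rw [singularCochain_homologyMap_eq R H, op_id, CategoryTheory.Functor.map_id,
      HomologicalComplex.homologyMap_id]
  inv_hom_id := by
    rw [← HomologicalComplex.homologyMap_comp, ← Functor.map_comp, ← op_comp]
    have H : TopCat.Homotopy (TopCat.ofHom e.invFun ≫ TopCat.ofHom e.toFun) (𝟙 (TopCat.of Y)) :=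
      e.right_inv.some
    rw [singularCochain_homologyMap_eq R H, op_id, CategoryTheory.Functor.map_id,
      HomologicalComplex.homologyMap_id]

end Cohomology

section CircleCohomology

open AlgebraicTopology Opposite

theorem exists_int_antidifference (u : ℤ → ℤ) : ∃ F : ℤ → ℤ, ∀ n, F (n + 1) - F n = u n := by
  refine ⟨fun n => match n with
    | .ofNat n => ∑ i ∈ Finset.range n, u i
    | .negSucc n => -∑ i ∈ Finset.range (n + 1), u (-(i + 1 : ℤ)), fun n => ?_⟩
  match n with
  | .ofNat n =>
    change ∑ i ∈ Finset.range (n + 1), u i - ∑ i ∈ Finset.range n, u i = u n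
    rw [Finset.sum_range_succ]; ring
  | .negSucc 0 =>
    change ∑ i ∈ Finset.range 0, u i - -∑ i ∈ Finset.range (0 + 1), u (-(i + 1 : ℤ)) = u (-1)
    simp
  | .negSucc (n + 1) =>
    change -∑ i ∈ Finset.range (n + 1), u (-(i + 1 : ℤ))
      - -∑ i ∈ Finset.range (n + 1 + 1), u (-(i + 1 : ℤ)) = _
    rw [Finset.sum_range_succ _ (n + 1)]
    simp [Int.negSucc_eq]

theorem exists_factor_of_invariant {A B : Type} {p : A → B} (hp : Function.Surjective p)
    {τ : ℤ → A → A} (h0 : ∀ a, τ 0 a = a) (hadd : ∀ m n a, τ (m + n) a = τ m (τ n a))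
    (horb : ∀ a b, p a = p b → ∃ n, b = τ n a) {φ : A → ℤ} (hφ : ∀ a, φ (τ 1 a) = φ a) :
    ∃ ψ : B → ℤ, ∀ a, ψ (p a) = φ a := by
  have key : ∀ n a, φ (τ n a) = φ a := by
    intro n a
    induction n using Int.induction_on with
    | zero => rw [h0]
    | succ n ih => rw [add_comm, hadd, hφ, ih]
    | pred n ih =>
      rw [← ih, ← hφ (τ (-n - 1) a), ← hadd]
      congr 2; ring
  refine ⟨fun b => φ (Function.surjInv hp b), fun a => ?_⟩
  obtain ⟨n, hn⟩ := horb _ _ (Function.surjInv_eq hp (p a)).symm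
  simp only
  rw [hn, key]

theorem exists_antidifference {A B : Type} {p : A → B} (hp : Function.Surjective p)
    {τ : ℤ → A → A} (hadd : ∀ m n a, τ (m + n) a = τ m (τ n a))
    (hpτ : ∀ n a, p (τ n a) = p a)
    (horb : ∀ a b, p a = p b → ∃ n, b = τ n a) (hfree : ∀ m n a, τ m a = τ n a → m = n)
    (ψ : A → ℤ) : ∃ φ : A → ℤ, ∀ a, φ (τ 1 a) - φ a = ψ a := by
  choose F hF using fun b => exists_int_antidifference (fun n => ψ (τ n (Function.surjInv hp b)))
  choose N hN using fun a => horb _ _ (Function.surjInv_eq hp (p a))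
  refine ⟨fun a => F (p a) (N a), fun a => ?_⟩
  have h1 : N (τ 1 a) = N a + 1 := by
    apply hfree _ _ (Function.surjInv hp (p a))
    rw [add_comm, hadd, ← hN a]
    have := hN (τ 1 a)
    rw [hpτ] at this
    exact this.symm
  simp only [h1, hpτ, hF]
  rw [← hN]

/-- The punctured complex plane. -/
abbrev PuncturedPlane : Type := {z : ℂ // z ≠ 0}

/-- The exponential covering of the punctured plane. -/
noncomputable def expCover : TopCat.of ℂ ⟶ TopCat.of PuncturedPlane :=
  TopCat.ofHom ⟨fun z => ⟨_, z.exp_ne_zero⟩, by fun_prop⟩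

/-- The deck translation by `2πin`. -/
noncomputable def deckTranslation (n : ℤ) : TopCat.of ℂ ⟶ TopCat.of ℂ :=
  TopCat.ofHom ⟨fun z => z + n * (2 * Real.pi * Complex.I), by fun_prop⟩

theorem deckTranslation_expCover (n : ℤ) : deckTranslation n ≫ expCover = expCover := by
  ext z
  exact Complex.exp_periodic.int_mul n z

theorem deckTranslation_zero : deckTranslation 0 = 𝟙 _ := by
  ext z
  simp [deckTranslation]

theorem deckTranslation_add (m n : ℤ) :
    deckTranslation (m + n) = deckTranslation n ≫ deckTranslation m := by
  ext z
  simp [deckTranslation]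
  ring

instance (n : SimplexCategory) : SimplyConnectedSpace (SimplexCategory.toTop.{0}.obj n) := by
  have : ContractibleSpace (stdSimplex ℝ (Fin (n.len + 1))) :=
    (convex_stdSimplex ℝ _).contractibleSpace
      ⟨_, (Classical.arbitrary (stdSimplex ℝ (Fin (n.len + 1)))).2⟩
  have : ContractibleSpace (SimplexCategory.toTop.{0}.obj n) :=
    (Homeomorph.ulift.{0} (X := stdSimplex ℝ (Fin (n.len + 1)))).contractibleSpace
  infer_instance

instance (n : SimplexCategory) : LocallyPathConnectedSpace (SimplexCategory.toTop.{0}.obj n) := by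
  have : LocallyPathConnectedSpace (stdSimplex ℝ (Fin (n.len + 1))) :=
    (convex_stdSimplex ℝ _).locallyPathConnectedSpace
  have h := (Homeomorph.ulift.{0} (X := stdSimplex ℝ (Fin (n.len + 1)))).symm.isQuotientMap
  exact h.locallyPathConnectedSpace

theorem expCover_lift (n : SimplexCategory)
    (f : SimplexCategory.toTop.{0}.obj n ⟶ TopCat.of PuncturedPlane) :
    ∃ g : SimplexCategory.toTop.{0}.obj n ⟶ TopCat.of ℂ, g ≫ expCover = f := by
  have a₀ : SimplexCategory.toTop.{0}.obj n := Classical.arbitrary _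
  obtain ⟨F, ⟨-, hF⟩, -⟩ := Complex.isCoveringMap_exp.existsUnique_continuousMap_lifts f.hom a₀
    (Complex.log (f.hom a₀).1) (Subtype.ext (Complex.exp_log (f.hom a₀).2))
  refine ⟨TopCat.ofHom F, ?_⟩
  ext x
  exact congrArg Subtype.val (congrFun hF x)

theorem expCover_orbit (n : SimplexCategory) (f g : SimplexCategory.toTop.{0}.obj n ⟶ TopCat.of ℂ)
    (h : f ≫ expCover = g ≫ expCover) : ∃ k : ℤ, g = f ≫ deckTranslation k := by
  have a₀ : SimplexCategory.toTop.{0}.obj n := Classical.arbitrary _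
  have h' : ∀ x, Complex.exp (f.hom x) = Complex.exp (g.hom x) := fun x =>
    congrArg Subtype.val (ConcreteCategory.congr_hom h x)
  obtain ⟨k, hk⟩ := Complex.exp_eq_exp_iff_exists_int.1 (h' a₀).symm
  refine ⟨k, ?_⟩
  obtain ⟨F, -, hF⟩ := Complex.isCoveringMap_exp.existsUnique_continuousMap_lifts
    (g ≫ expCover).hom a₀ (g.hom a₀) rfl
  have h1 := hF g.hom ⟨rfl, rfl⟩
  have h2 := hF (f ≫ deckTranslation k).hom ⟨hk.symm, by
    rw [← h, ← deckTranslation_expCover k]; rfl⟩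
  exact TopCat.hom_ext (h1.trans h2.symm)

/-- Evaluation of a singular cochain at a singular simplex. -/
noncomputable def cochainEval {X : TopCat} {n : ℕ}
    (φ : ((singularCochainComplexFunctor ℤ).obj (op X)).X n)
    (s : (TopCat.toSSet.obj X).obj (op (SimplexCategory.mk n))) : ℤ :=
  ModuleCat.Hom.hom (show
    (ModuleCat.free ℤ).obj ((TopCat.toSSet.obj X).obj (op (SimplexCategory.mk n))) ⟶
    ModuleCat.of ℤ ℤ from φ) (ModuleCat.freeMk s)

theorem cochainEval_ext {X : TopCat} {n : ℕ}
    {φ ψ : ((singularCochainComplexFunctor ℤ).obj (op X)).X n}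
    (h : ∀ s, cochainEval φ s = cochainEval ψ s) : φ = ψ :=
  ModuleCat.free_hom_ext (M := ModuleCat.of ℤ ℤ) h

theorem cochainEval_surjective {X : TopCat} {n : ℕ}
    (u : (TopCat.toSSet.obj X).obj (op (SimplexCategory.mk n)) → ℤ) :
    ∃ φ : ((singularCochainComplexFunctor ℤ).obj (op X)).X n, ∀ s, cochainEval φ s = u s :=
  ⟨ModuleCat.freeDesc (M := ModuleCat.of ℤ ℤ) (TypeCat.ofHom u), fun s =>
    ModuleCat.freeDesc_apply (M := ModuleCat.of ℤ ℤ) (TypeCat.ofHom u) s⟩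

theorem cochainEval_map {X Y : TopCat} (f : X ⟶ Y) {n : ℕ}
    (φ : ((singularCochainComplexFunctor ℤ).obj (op Y)).X n)
    (s : (TopCat.toSSet.obj X).obj (op (SimplexCategory.mk n))) :
    cochainEval ((((singularCochainComplexFunctor ℤ).map f.op).f n).hom φ) s =
      cochainEval φ ((TopCat.toSSet.map f).app _ s) := by
  exact congrArg (ModuleCat.Hom.hom (show (ModuleCat.free ℤ).obj
    ((TopCat.toSSet.obj Y).obj (op (SimplexCategory.mk n))) ⟶ ModuleCat.of ℤ ℤ from φ))
    (ModuleCat.free_map_apply ((TopCat.toSSet.map f).app _) s)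

theorem cochainEval_sub {X : TopCat} {n : ℕ}
    (φ ψ : ((singularCochainComplexFunctor ℤ).obj (op X)).X n)
    (s : (TopCat.toSSet.obj X).obj (op (SimplexCategory.mk n))) :
    cochainEval (φ - ψ) s = cochainEval φ s - cochainEval ψ s := rfl


/-- The short exact sequence of singular cochain complexes of the exponential covering. -/
noncomputable def expCoverShortComplex :
    ShortComplex (HomologicalComplex (ModuleCat ℤ) (ComplexShape.down ℕ).symm) where
  f := (singularCochainComplexFunctor ℤ).map expCover.op
  g := (singularCochainComplexFunctor ℤ).map (deckTranslation 1).op - 𝟙 _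
  zero := by
    rw [Preadditive.comp_sub, ← Functor.map_comp, ← op_comp, deckTranslation_expCover,
      Category.comp_id, sub_self]

theorem toSSet_expCover_surjective (n : ℕ) :
    Function.Surjective ((TopCat.toSSet.map expCover).app (op (SimplexCategory.mk n))) := by
  rintro ⟨s⟩
  obtain ⟨g, hg⟩ := expCover_lift _ s
  exact ⟨⟨g⟩, congrArg ULift.up hg⟩

theorem toSSet_expCover_orbit (n : ℕ)
    (a b : (TopCat.toSSet.obj (TopCat.of ℂ)).obj (op (SimplexCategory.mk n)))
    (h : (TopCat.toSSet.map expCover).app _ a = (TopCat.toSSet.map expCover).app _ b) :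
    ∃ k, b = (TopCat.toSSet.map (deckTranslation k)).app _ a := by
  obtain ⟨k, hk⟩ := expCover_orbit _ a.down b.down (congrArg ULift.down h)
  exact ⟨k, congrArg ULift.up hk⟩

theorem toSSet_deckTranslation_zero (n : ℕ)
    (a : (TopCat.toSSet.obj (TopCat.of ℂ)).obj (op (SimplexCategory.mk n))) :
    (TopCat.toSSet.map (deckTranslation 0)).app _ a = a := by
  rw [deckTranslation_zero, CategoryTheory.Functor.map_id]
  rfl

theorem toSSet_deckTranslation_add (n : ℕ) (k l : ℤ)
    (a : (TopCat.toSSet.obj (TopCat.of ℂ)).obj (op (SimplexCategory.mk n))) :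
    (TopCat.toSSet.map (deckTranslation (k + l))).app _ a =
      (TopCat.toSSet.map (deckTranslation k)).app _
        ((TopCat.toSSet.map (deckTranslation l)).app _ a) := by
  rw [deckTranslation_add, CategoryTheory.Functor.map_comp]
  rfl

theorem toSSet_deckTranslation_expCover (n : ℕ) (k : ℤ)
    (a : (TopCat.toSSet.obj (TopCat.of ℂ)).obj (op (SimplexCategory.mk n))) :
    (TopCat.toSSet.map expCover).app _ ((TopCat.toSSet.map (deckTranslation k)).app _ a) =
      (TopCat.toSSet.map expCover).app _ a := by
  conv_rhs => rw [← deckTranslation_expCover k, CategoryTheory.Functor.map_comp]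
  rfl

theorem toSSet_deckTranslation_free (n : ℕ) (k l : ℤ)
    (a : (TopCat.toSSet.obj (TopCat.of ℂ)).obj (op (SimplexCategory.mk n)))
    (h : (TopCat.toSSet.map (deckTranslation k)).app _ a =
      (TopCat.toSSet.map (deckTranslation l)).app _ a) : k = l := by
  have h1 := congrArg ULift.down h
  let x₀ := Classical.arbitrary (SimplexCategory.toTop.{0}.obj (SimplexCategory.mk n))
  have h2 : a.down.hom x₀ + k * (2 * Real.pi * Complex.I) = a.down.hom x₀ +
      l * (2 * Real.pi * Complex.I) := ConcreteCategory.congr_hom h1 _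
  simpa [Complex.two_pi_I_ne_zero, Real.pi_ne_zero] using h2

theorem expCoverShortComplex_shortExact : expCoverShortComplex.ShortExact := by
  refine HomologicalComplex.shortExact_of_degreewise_shortExact _ fun n => ?_
  have hp := toSSet_expCover_surjective n
  refine ShortComplex.ShortExact.mk' ?_ ?_ ?_
  · rw [ShortComplex.moduleCat_exact_iff]
    intro (φ : ((singularCochainComplexFunctor ℤ).obj (op (TopCat.of ℂ))).X n) hφ
    obtain ⟨ψ, hψ⟩ := exists_factor_of_invariant hp (toSSet_deckTranslation_zero n)
      (toSSet_deckTranslation_add n) (toSSet_expCover_orbit n) (φ := cochainEval φ) (fun a => by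
        have h1 : cochainEval ((((singularCochainComplexFunctor ℤ).map
          (deckTranslation 1).op).f n).hom φ - φ) a = cochainEval 0 a :=
        congrArg (cochainEval · a) hφ
        rw [cochainEval_sub, cochainEval_map] at h1
        exact sub_eq_zero.1 h1)
    obtain ⟨χ, hχ⟩ := cochainEval_surjective ψ
    refine ⟨χ, cochainEval_ext fun s => ?_⟩
    exact (cochainEval_map expCover χ s).trans ((hχ _).trans (hψ s))
  · rw [ModuleCat.mono_iff_injective]
    intro (φ : ((singularCochainComplexFunctor ℤ).obj (op (TopCat.of PuncturedPlane))).X n)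
      (ψ : ((singularCochainComplexFunctor ℤ).obj (op (TopCat.of PuncturedPlane))).X n) h
    refine cochainEval_ext fun s => ?_
    obtain ⟨a, rfl⟩ := hp s
    exact (cochainEval_map expCover φ a).symm.trans
      ((congrArg (cochainEval · a) h).trans (cochainEval_map expCover ψ a))
  · rw [ModuleCat.epi_iff_surjective]
    intro ψ
    obtain ⟨φ, hφ⟩ := exists_antidifference hp
      (toSSet_deckTranslation_add n) (toSSet_deckTranslation_expCover n) (toSSet_expCover_orbit n)
      (fun m k a => toSSet_deckTranslation_free n m k a) (cochainEval ψ)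
    obtain ⟨χ, hχ⟩ := cochainEval_surjective φ
    refine ⟨χ, cochainEval_ext fun s => ?_⟩
    refine Eq.trans ?_ (hφ s)
    rw [← hχ, ← hχ, ← cochainEval_map]
    rfl

end CircleCohomology

section PointCohomology

open AlgebraicTopology Opposite

theorem free_sum_map_comp_apply {S T : Type} {ι : Type} [Fintype ι] (c : ι → ℤ) (g : ι → (S ⟶ T))
    (L : (ModuleCat.free ℤ).obj T ⟶ ModuleCat.of ℤ ℤ) (s : S) :
    L.hom ((∑ i, c i • (ModuleCat.free ℤ).map (g i)).hom (ModuleCat.freeMk s)) =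
      ∑ i, c i * L.hom (ModuleCat.freeMk (g i s)) := by
  rw [ModuleCat.hom_sum, LinearMap.sum_apply, map_sum]
  refine Finset.sum_congr rfl fun i _ => ?_
  rw [ModuleCat.hom_zsmul]
  refine (map_zsmul L.hom (c i) _).trans ?_
  exact congrArg (fun y => c i * L.hom y) (ModuleCat.free_map_apply (g i) s)

theorem down_symm_rel (n : ℕ) : (ComplexShape.down ℕ).symm.Rel n (n + 1) := rfl

theorem not_down_symm_rel_zero (n : ℕ) : ¬ (ComplexShape.down ℕ).symm.Rel n 0 := n.succ_ne_zero

theorem cochainEval_d {X : TopCat} {n : ℕ}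
    (φ : ((singularCochainComplexFunctor ℤ).obj (op X)).X n)
    (s : (TopCat.toSSet.obj X).obj (op (SimplexCategory.mk (n + 1)))) :
    cochainEval ((((singularCochainComplexFunctor ℤ).obj (op X)).d n (n + 1)).hom φ) s =
      ∑ i : Fin (n + 2), (-1) ^ (i : ℕ) * cochainEval φ ((TopCat.toSSet.obj X).δ i s) := by
  have h : ((singularChainComplexFunctor ℤ).obj X).d (n + 1) n =
      ∑ i : Fin (n + 2), (-1 : ℤ) ^ (i : ℕ) • (ModuleCat.free ℤ).map ((TopCat.toSSet.obj X).δ i) :=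
    AlternatingFaceMapComplex.obj_d_eq
      (((SimplicialObject.whiskering _ _).obj (ModuleCat.free ℤ)).obj (TopCat.toSSet.obj X)) n
  have h1 : cochainEval ((((singularCochainComplexFunctor ℤ).obj (op X)).d n (n + 1)).hom φ) s =
    ModuleCat.Hom.hom (show (ModuleCat.free ℤ).obj
      ((TopCat.toSSet.obj X).obj (op (SimplexCategory.mk n))) ⟶ ModuleCat.of ℤ ℤ from φ)
      ((((singularChainComplexFunctor ℤ).obj X).d (n + 1) n).hom (ModuleCat.freeMk s)) := rfl
  exact (h1.trans (congrArg (fun y => ModuleCat.Hom.hom (show (ModuleCat.free ℤ).obj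
      ((TopCat.toSSet.obj X).obj (op (SimplexCategory.mk n))) ⟶ ModuleCat.of ℤ ℤ from φ)
      (ModuleCat.Hom.hom y (ModuleCat.freeMk s))) h)).trans (free_sum_map_comp_apply _ _ _ s)

theorem sum_neg_one_pow_fin (n : ℕ) :
    ∑ i : Fin (n + 2), (-1 : ℤ) ^ (i : ℕ) = if Even n then 0 else 1 := by
  rw [Fin.sum_univ_eq_sum_range (fun i => (-1 : ℤ) ^ i), neg_one_geom_sum]
  simp [Nat.even_add]

noncomputable instance (n : ℕ) :
    Unique ((TopCat.toSSet.obj (TopCat.of Unit)).obj (op (SimplexCategory.mk n))) where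
  default := ⟨TopCat.ofHom ⟨fun _ => (), continuous_const⟩⟩
  uniq _ := ULift.ext _ _ (TopCat.hom_ext (ContinuousMap.ext fun _ => rfl))

theorem cochainEval_d_point {n : ℕ}
    (φ : ((singularCochainComplexFunctor ℤ).obj (op (TopCat.of Unit))).X n) :
    cochainEval ((((singularCochainComplexFunctor ℤ).obj (op (TopCat.of Unit))).d n (n + 1)).hom φ)
      default = if Even n then 0 else cochainEval φ default := by
  rw [cochainEval_d]
  simp_rw [fun i => Subsingleton.elim ((TopCat.toSSet.obj (TopCat.of Unit)).δ (n := n) i default)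
    default]
  rw [← Finset.sum_mul, sum_neg_one_pow_fin]
  split_ifs <;> simp

theorem cochain_point_ext {n : ℕ}
    {φ ψ : ((singularCochainComplexFunctor ℤ).obj (op (TopCat.of Unit))).X n}
    (h : cochainEval φ default = cochainEval ψ default) : φ = ψ :=
  cochainEval_ext fun s => by rw [Subsingleton.elim s default, h]

theorem exactAt_point (n : ℕ) :
    ((singularCochainComplexFunctor ℤ).obj (op (TopCat.of Unit))).ExactAt (n + 1) := by
  rw [HomologicalComplex.exactAt_iff' _ n (n + 1) (n + 2)
      (ComplexShape.prev_eq' _ (down_symm_rel n)) (ComplexShape.next_eq' _ (down_symm_rel (n + 1))),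
    ShortComplex.moduleCat_exact_iff]
  intro (φ : ((singularCochainComplexFunctor ℤ).obj (op (TopCat.of Unit))).X (n + 1)) hφ
  have h1 := cochainEval_d_point φ
  have h2 : (((singularCochainComplexFunctor ℤ).obj (op (TopCat.of Unit))).d (n + 1)
    (n + 2)).hom φ = 0 := hφ
  rw [h2] at h1
  by_cases hn : Even n
  · have : ¬ Even (n + 1) := by simpa [Nat.even_add_one] using hn
    rw [if_neg this] at h1
    refine ⟨0, ?_⟩
    rw [map_zero]
    exact cochain_point_ext h1
  · obtain ⟨ψ, hψ⟩ := cochainEval_surjective (X := TopCat.of Unit) (n := n)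
      (fun _ => cochainEval φ default)
    refine ⟨ψ, cochain_point_ext ((cochainEval_d_point ψ).trans ?_)⟩
    rw [if_neg hn, hψ]

theorem homology_point_zero : Nonempty
    (((singularCochainComplexFunctor ℤ).obj (op (TopCat.of Unit))).homology 0 ≃ₗ[ℤ] ℤ) := by
  let K := (singularCochainComplexFunctor ℤ).obj (op (TopCat.of Unit))
  have hd : K.d 0 1 = 0 := by
    ext φ
    refine cochain_point_ext ((cochainEval_d_point φ).trans ?_)
    rw [if_pos Even.zero]
    rfl
  have := K.isIso_iCycles 0 1 (ComplexShape.next_eq' _ (down_symm_rel 0)) hd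
  have : IsIso (K.homologyπ 0) :=
    ShortComplex.isIso_homologyπ _ (K.shape _ _ (not_down_symm_rel_zero _))
  let e : K.homology 0 ≅ K.X 0 := (asIso (K.homologyπ 0)).symm ≪≫ asIso (K.iCycles 0)
  let ev : K.X 0 →ₗ[ℤ] ℤ := 
    { toFun := fun φ => cochainEval φ default
      map_add' := fun _ _ => rfl
      map_smul' := fun _ _ => rfl }
  refine ⟨e.toLinearEquiv ≪≫ₗ LinearEquiv.ofBijective ev
    ⟨fun _ _ h => cochain_point_ext h, fun m => ?_⟩⟩
  obtain ⟨ψ, hψ⟩ := cochainEval_surjective (X := TopCat.of Unit) (n := 0) (fun _ => m)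
  exact ⟨ψ, hψ _⟩

end PointCohomology

section PuncturedPlaneCohomology

open AlgebraicTopology Opposite Limits

noncomputable def homologyComplexPlaneIso (n : ℕ) :
    ((singularCochainComplexFunctor ℤ).obj (op (TopCat.of ℂ))).homology n ≅
      ((singularCochainComplexFunctor ℤ).obj (op (TopCat.of Unit))).homology n :=
  singularCohomologyIsoOfHomotopyEquiv ℤ (ContractibleSpace.hequiv ℂ Unit).some n

theorem homologyMap_expCoverShortComplex_g (n : ℕ) :
    HomologicalComplex.homologyMap expCoverShortComplex.g n = 0 := by
  have H : TopCat.Homotopy (deckTranslation 1) (𝟙 _) :=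
    ⟨⟨fun x => x.2 + (1 - (x.1 : ℝ) : ℂ) * (2 * Real.pi * Complex.I), by fun_prop⟩,
      fun x => by simp [deckTranslation], fun x => by simp⟩
  refine (HomologicalComplex.homologyMap_sub
    ((singularCochainComplexFunctor ℤ).map (deckTranslation 1).op) (𝟙 _) n).trans ?_
  rw [singularCochain_homologyMap_eq ℤ H, op_id, CategoryTheory.Functor.map_id]
  exact sub_self _

theorem isZero_homology_complexPlane (n : ℕ) :
    IsZero (((singularCochainComplexFunctor ℤ).obj (op (TopCat.of ℂ))).homology (n + 1)) :=
  (exactAt_point n).isZero_homology.of_iso (homologyComplexPlaneIso _)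

theorem mono_homologyMap_expCover_zero :
    Mono (HomologicalComplex.homologyMap expCoverShortComplex.f 0) := by
  have h (K : HomologicalComplex (ModuleCat ℤ) (ComplexShape.down ℕ).symm) :
      IsIso (K.homologyπ 0) :=
    ShortComplex.isIso_homologyπ _ (K.shape _ _ (not_down_symm_rel_zero _))
  have := h expCoverShortComplex.X₁
  have := h expCoverShortComplex.X₂
  have := expCoverShortComplex_shortExact.mono_f
  have h1 : Mono (expCoverShortComplex.f.f 0) := inferInstance
  have h2 : Mono (HomologicalComplex.cyclesMap expCoverShortComplex.f 0) := by
    have : Mono (HomologicalComplex.cyclesMap expCoverShortComplex.f 0 ≫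
        expCoverShortComplex.X₂.iCycles 0) := by
      rw [HomologicalComplex.cyclesMap_i]
      infer_instance
    exact mono_of_mono _ (expCoverShortComplex.X₂.iCycles 0)
  have h3 : HomologicalComplex.homologyMap expCoverShortComplex.f 0 =
      inv (expCoverShortComplex.X₁.homologyπ 0) ≫
        HomologicalComplex.cyclesMap expCoverShortComplex.f 0 ≫
          expCoverShortComplex.X₂.homologyπ 0 := by
    rw [← HomologicalComplex.homologyπ_naturality, IsIso.inv_hom_id_assoc]
  rw [h3]
  infer_instance

/-- The integral cohomology of the punctured plane. -/
theorem cohomology_puncturedPlane :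
    Nonempty (singularCohomology ℤ (TopCat.of PuncturedPlane) 0 ≃ₗ[ℤ] ℤ) ∧
      Nonempty (singularCohomology ℤ (TopCat.of PuncturedPlane) 1 ≃ₗ[ℤ] ℤ) ∧
      ∀ i : ℕ, 2 ≤ i → Subsingleton (singularCohomology ℤ (TopCat.of PuncturedPlane) i) := by
  have hS := expCoverShortComplex_shortExact
  obtain ⟨e₀⟩ := homology_point_zero
  have e : expCoverShortComplex.X₂.homology 0 ≃ₗ[ℤ] ℤ :=
    (homologyComplexPlaneIso 0).toLinearEquiv ≪≫ₗ e₀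
  refine ⟨?_, ?_, ?_⟩
  · have : Epi (HomologicalComplex.homologyMap expCoverShortComplex.f 0) :=
      (hS.homology_exact₂ 0).epi_f (homologyMap_expCoverShortComplex_g 0)
    have := mono_homologyMap_expCover_zero
    have := isIso_of_mono_of_epi (HomologicalComplex.homologyMap expCoverShortComplex.f 0)
    exact ⟨(asIso (HomologicalComplex.homologyMap expCoverShortComplex.f 0)).toLinearEquiv ≪≫ₗ e⟩
  · have : Mono (hS.δ 0 1 (down_symm_rel _)) :=
      (hS.homology_exact₃ 0 1 (down_symm_rel _)).mono_g (homologyMap_expCoverShortComplex_g 0)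
    have : Epi (hS.δ 0 1 (down_symm_rel _)) := hS.epi_δ _ _ _ (isZero_homology_complexPlane 0)
    have := isIso_of_mono_of_epi (hS.δ 0 1 (down_symm_rel _))
    exact ⟨(asIso (hS.δ 0 1 (down_symm_rel _))).toLinearEquiv.symm ≪≫ₗ e⟩
  · intro i hi
    obtain ⟨n, rfl⟩ := Nat.exists_eq_add_of_le' hi
    have := hS.epi_δ (n + 1) (n + 2) (down_symm_rel _) (isZero_homology_complexPlane (n + 1))
    have h : IsZero (expCoverShortComplex.X₁.homology (n + 2)) :=
      IsZero.of_epi (hS.δ (n + 1) (n + 2) (down_symm_rel _)) (isZero_homology_complexPlane n)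
    exact ModuleCat.subsingleton_of_isZero h

end PuncturedPlaneCohomology

section Components

open ContinuousMap

instance : PathConnectedSpace PuncturedPlane := by
  have h := isPathConnected_compl_singleton_of_one_lt_rank (E := ℂ)
    (by rw [Complex.rank_real_complex]; exact Nat.one_lt_ofNat) 0
  exact isPathConnected_iff_pathConnectedSpace.1 h

theorem ContinuousMap.HomotopyEquiv.pathConnectedSpace {X Y : Type*} [TopologicalSpace X]
    [TopologicalSpace Y] (e : X ≃ₕ Y) [PathConnectedSpace Y] : PathConnectedSpace X where
  nonempty := PathConnectedSpace.nonempty.map e.invFun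
  joined x y := by
    have H := e.left_inv.some
    have h (x : X) : Joined (e.invFun (e.toFun x)) x := ⟨H.evalAt x⟩
    exact ((h x).symm.trans ((PathConnectedSpace.joined (e.toFun x) (e.toFun y)).map
      e.invFun.continuous)).trans (h y)

theorem ContinuousMap.Homotopy.comp_discrete_eq {X Y ι : Type*} [TopologicalSpace X]
    [TopologicalSpace Y] [TopologicalSpace ι] [DiscreteTopology ι] {f g : C(X, Y)}
    (H : f.Homotopy g) {κ : Y → ι} (hκ : Continuous κ) (t : unitInterval) (x : X) :
    κ (H (t, x)) = κ (f x) := by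
  have h := PreconnectedSpace.constant (f := fun t => κ (H (t, x))) inferInstance
    (by fun_prop) (x := t) (y := 0)
  simpa using h

/-- A homotopy equivalence restricts to the fibres of a locally constant function. -/
theorem ContinuousMap.HomotopyEquiv.nonempty_fibre {X Y ι : Type*} [TopologicalSpace X]
    [TopologicalSpace Y] [TopologicalSpace ι] [DiscreteTopology ι] (e : X ≃ₕ Y) {κ : Y → ι}
    (hκ : Continuous κ) (k : ι) :
    Nonempty ({x : X // κ (e.toFun x) = k} ≃ₕ {y : Y // κ y = k}) := by
  have H := e.left_inv.some
  have H' := e.right_inv.some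
  have h1 (y : Y) : κ (e.toFun (e.invFun y)) = κ y := by
    simpa using (H'.comp_discrete_eq hκ 1 y).symm
  have h2 (t : unitInterval) (x : X) : κ (e.toFun (H (t, x))) = κ (e.toFun x) :=
    (H.comp_discrete_eq (hκ.comp e.toFun.continuous) t x).trans (h1 _)
  refine ⟨⟨⟨fun x => ⟨e.toFun x, x.2⟩, by fun_prop⟩,
    ⟨fun y => ⟨e.invFun y, (h1 y).trans y.2⟩, by fun_prop⟩, ⟨⟨⟨fun p => ⟨H (p.1, p.2.1),
      (h2 _ _).trans p.2.2⟩, by fun_prop⟩, fun x => ?_, fun x => ?_⟩⟩,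
      ⟨⟨⟨fun p => ⟨H' (p.1, p.2.1),
      ((H'.comp_discrete_eq hκ _ _).trans (h1 _)).trans p.2.2⟩, by fun_prop⟩,
        fun x => ?_, fun x => ?_⟩⟩⟩⟩
  all_goals exact Subtype.ext (by simp)

/-- A space with a locally constant function all of whose fibres are homotopy equivalent to the
punctured plane. -/
theorem components_of_fibres {N ι : Type} [TopologicalSpace N] [TopologicalSpace ι]
    [DiscreteTopology ι] {κ : N → ι} (hκ : Continuous κ)
    (he : ∀ k, Nonempty ({x : N // κ x = k} ≃ₕ PuncturedPlane)) :
    Nonempty (ConnectedComponents N ≃ ι) ∧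
    ∀ x : N,
      Nonempty (singularCohomology ℤ (TopCat.of (connectedComponent x)) 0 ≃ₗ[ℤ] ℤ) ∧
      Nonempty (singularCohomology ℤ (TopCat.of (connectedComponent x)) 1 ≃ₗ[ℤ] ℤ) ∧
      ∀ i : ℕ, 2 ≤ i →
        Subsingleton (singularCohomology ℤ (TopCat.of (connectedComponent x)) i) := by
  have hpc (k : ι) : PathConnectedSpace {x : N // κ x = k} := (he k).some.pathConnectedSpace
  have hcc (x : N) : connectedComponent x = {y | κ y = κ x} := by
    refine subset_antisymm (fun y hy => ?_) ?_
    · exact isPreconnected_connectedComponent.constant hκ.continuousOn hy mem_connectedComponent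
    · have : IsPreconnected {y | κ y = κ x} := by
        have := hpc (κ x)
        exact isPreconnected_iff_preconnectedSpace.2
          (inferInstanceAs (PreconnectedSpace {y : N // κ y = κ x}))
      exact this.subset_connectedComponent rfl
  constructor
  · refine ⟨Equiv.ofBijective (Quotient.lift κ fun x y hxy => ?_) ⟨?_, fun k => ?_⟩⟩
    · have : x ∈ connectedComponent y := by
        rw [← show connectedComponent x = connectedComponent y from hxy]
        exact mem_connectedComponent
      rw [hcc] at this
      exact this
    · rintro ⟨x⟩ ⟨y⟩ (h : κ x = κ y)
      exact Quotient.sound (show connectedComponent x = connectedComponent y by rw [hcc, hcc, h])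
    · obtain ⟨x, hx⟩ := (hpc k).nonempty.some
      exact ⟨Quotient.mk _ x, hx⟩
  · intro x
    have e : connectedComponent x ≃ₕ PuncturedPlane :=
      (Homeomorph.setCongr (hcc x)).toHomotopyEquiv.trans (he (κ x)).some
    have E (n : ℕ) : singularCohomology ℤ (TopCat.of (connectedComponent x)) n ≃ₗ[ℤ]
        singularCohomology ℤ (TopCat.of PuncturedPlane) n :=
      (singularCohomologyIsoOfHomotopyEquiv ℤ e n).toLinearEquiv
    obtain ⟨⟨e0⟩, ⟨e1⟩, e2⟩ := cohomology_puncturedPlane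
    exact ⟨⟨E 0 ≪≫ₗ e0⟩, ⟨E 1 ≪≫ₗ e1⟩, fun i hi => by
      have := e2 i hi
      exact (E i).injective.subsingleton⟩

end Components

section Forms

@[fun_prop]
theorem continuous_evalForm (d : ℕ) :
    Continuous fun p : (Fin (d + 1) → ℝ) × (ℝ × ℝ) => evalForm d p.1 p.2 := by
  unfold evalForm
  fun_prop

theorem evalForm_add (d : ℕ) (a b : Fin (d + 1) → ℝ) (v : ℝ × ℝ) :
    evalForm d (a + b) v = evalForm d a v + evalForm d b v := by
  simp [evalForm, add_mul, Finset.sum_add_distrib]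

theorem evalForm_smul (d : ℕ) (c : ℝ) (a : Fin (d + 1) → ℝ) (v : ℝ × ℝ) :
    evalForm d (c • a) v = c * evalForm d a v := by
  simp [evalForm, mul_assoc, Finset.mul_sum]

theorem evalForm_zero (d : ℕ) (v : ℝ × ℝ) : evalForm d 0 v = 0 := by
  simp [evalForm]

theorem evalForm_homogeneous (d : ℕ) (a : Fin (d + 1) → ℝ) (c : ℝ) (v : ℝ × ℝ) :
    evalForm d a (c • v) = c ^ d * evalForm d a v := by
  simp only [evalForm, Finset.mul_sum]
  refine Finset.sum_congr rfl fun i _ => ?_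
  have h : c ^ d = c ^ (d - (i : ℕ)) * c ^ (i : ℕ) := by
    rw [← pow_add, Nat.sub_add_cancel (Nat.le_of_lt_succ i.2)]
  simp only [Prod.smul_fst, Prod.smul_snd, smul_eq_mul, mul_pow, h]
  ring

/-- The function `f` is a binary form of degree `d`. -/
def IsForm (d : ℕ) (f : ℝ × ℝ → ℝ) : Prop := ∃ a, ∀ v, f v = evalForm d a v

theorem IsForm.add {d : ℕ} {f g : ℝ × ℝ → ℝ} (hf : IsForm d f) (hg : IsForm d g) :
    IsForm d (f + g) := by
  obtain ⟨a, ha⟩ := hf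
  obtain ⟨b, hb⟩ := hg
  exact ⟨a + b, fun v => by simp [evalForm_add, ha, hb]⟩

theorem IsForm.smul {d : ℕ} {f : ℝ × ℝ → ℝ} (hf : IsForm d f) (c : ℝ) : IsForm d (c • f) := by
  obtain ⟨a, ha⟩ := hf
  exact ⟨c • a, fun v => by simp [evalForm_smul, ha]⟩

theorem IsForm.sum {ι : Type*} {s : Finset ι} {d : ℕ} {f : ι → ℝ × ℝ → ℝ}
    (hf : ∀ i ∈ s, IsForm d (f i)) : IsForm d (∑ i ∈ s, f i) :=
  Finset.sum_induction _ (IsForm d) (fun _ _ => IsForm.add)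
    ⟨0, fun v => by simp [evalForm_zero]⟩ hf

theorem isForm_monomial (i j : ℕ) : IsForm (i + j) (fun v => v.1 ^ i * v.2 ^ j) := by
  refine ⟨Pi.single ⟨j, by omega⟩ 1, fun v => ?_⟩
  simp only [evalForm]
  rw [Finset.sum_eq_single ⟨j, by omega⟩]
  · simp
  · intro k _ hk
    simp [hk]
  · simp

theorem evalForm_eq_sum (d : ℕ) (a : Fin (d + 1) → ℝ) :
    evalForm d a =
      ∑ i : Fin (d + 1), a i • fun v : ℝ × ℝ => v.1 ^ (d - (i : ℕ)) * v.2 ^ (i : ℕ) := by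
  ext v
  simp [evalForm, Finset.sum_apply, mul_assoc]

theorem IsForm.mul {d e : ℕ} {f g : ℝ × ℝ → ℝ} (hf : IsForm d f) (hg : IsForm e g) :
    IsForm (d + e) (f * g) := by
  obtain ⟨a, ha⟩ := hf
  obtain ⟨b, hb⟩ := hg
  rw [funext ha, funext hb]
  change IsForm _ (evalForm d a * evalForm e b)
  rw [evalForm_eq_sum, evalForm_eq_sum, Finset.sum_mul_sum]
  refine IsForm.sum fun i _ => IsForm.sum fun j _ => ?_
  have h := (isForm_monomial ((d - i) + (e - j)) (i + j)).smul (a i * b j)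
  rw [show (d - (i : ℕ)) + (e - j) + (i + j) = d + e by omega] at h
  convert h using 1
  ext v
  simp
  ring

theorem isForm_one : IsForm 0 1 := by
  simpa [Pi.one_def] using isForm_monomial 0 0

theorem isForm_fst : IsForm 1 Prod.fst := by
  simpa using isForm_monomial 1 0

theorem isForm_snd : IsForm 1 Prod.snd := by
  simpa using isForm_monomial 0 1

theorem IsForm.pow {d : ℕ} {f : ℝ × ℝ → ℝ} (hf : IsForm d f) (m : ℕ) :
    IsForm (m * d) (f ^ m) := by
  induction m with
  | zero => simpa using isForm_one
  | succ m ih => simpa [pow_succ, add_mul] using ih.mul hf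

theorem isForm_normSq : IsForm 2 (fun v => v.1 ^ 2 + v.2 ^ 2) := by
  have h := (isForm_monomial 2 0).add (isForm_monomial 0 2)
  simpa [Pi.add_def] using h

theorem normSq_pos {v : ℝ × ℝ} (hv : v ≠ 0) : 0 < v.1 ^ 2 + v.2 ^ 2 := by
  by_contra! h
  exact hv (Prod.ext (by simpa using by nlinarith [sq_nonneg v.1, sq_nonneg v.2])
    (by simpa using by nlinarith [sq_nonneg v.1, sq_nonneg v.2]))

/-- Multiplication by a form is given by a continuous map on coefficients. -/
theorem IsForm.exists_continuous_mul {e : ℕ} {q : ℝ × ℝ → ℝ} (hq : IsForm e q) (d : ℕ) :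
    ∃ L : (Fin (d + 1) → ℝ) → (Fin (d + e + 1) → ℝ), Continuous L ∧
      ∀ a v, evalForm (d + e) (L a) v = evalForm d a v * q v := by
  have h (i : Fin (d + 1)) : ∃ b, ∀ v : ℝ × ℝ,
      (v.1 ^ (d - (i : ℕ)) * v.2 ^ (i : ℕ)) * q v = evalForm (d + e) b v := by
    have := isForm_monomial (d - i) i
    rw [Nat.sub_add_cancel (Nat.le_of_lt_succ i.2)] at this
    exact this.mul hq
  choose b hb using h
  refine ⟨fun a => ∑ i, a i • b i, by fun_prop, fun a v => ?_⟩
  have h1 : evalForm (d + e) (∑ i, a i • b i) v = ∑ i, a i * evalForm (d + e) (b i) v := by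
    simp only [evalForm, Finset.sum_apply, Pi.smul_apply, smul_eq_mul, Finset.sum_mul,
      Finset.mul_sum]
    rw [Finset.sum_comm]
    simp only [mul_assoc]
  rw [h1]
  simp_rw [← hb]
  rw [evalForm, Finset.sum_mul]
  exact Finset.sum_congr rfl fun i _ => by ring

open Polynomial in
/-- Restriction of a form to an affine line is a polynomial. -/
theorem exists_polynomial_evalForm (d : ℕ) (a : Fin (d + 1) → ℝ) (w u : ℝ × ℝ) :
    ∃ p : ℝ[X], p.natDegree ≤ d ∧ p.coeff d = evalForm d a w ∧
      ∀ s, p.eval s = evalForm d a (s • w + u) := by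
  have hdeg (i : Fin (d + 1)) : ((C w.1 * X + C u.1) ^ (d - (i : ℕ)) *
      (C w.2 * X + C u.2) ^ (i : ℕ)).natDegree ≤ d := by
    compute_degree
    omega
  refine ⟨∑ i : Fin (d + 1), C (a i) * ((C w.1 * X + C u.1) ^ (d - (i : ℕ)) *
    (C w.2 * X + C u.2) ^ (i : ℕ)), ?_, ?_, fun s => ?_⟩
  · exact natDegree_sum_le_of_forall_le _ _ fun i _ => (natDegree_C_mul_le _ _).trans (hdeg i)
  · rw [finsetSum_coeff, evalForm]
    refine Finset.sum_congr rfl fun i _ => ?_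
    have h1 (α β : ℝ) (n : ℕ) : ((C α * X + C β) ^ n).coeff n = α ^ n := by
      simpa using coeff_pow_of_natDegree_le (p := C α * X + C β) (n := 1) (m := n)
        natDegree_linear_le
    have h2 (α β : ℝ) (n : ℕ) : ((C α * X + C β) ^ n).natDegree ≤ n := by
      compute_degree
    have h3 := coeff_mul_add_eq_of_natDegree_le (h2 w.1 u.1 (d - i)) (h2 w.2 u.2 i)
    rw [Nat.sub_add_cancel (Nat.le_of_lt_succ i.2)] at h3
    rw [coeff_C_mul, h3, h1, h1, mul_assoc]
  · simp only [eval_finsetSum, evalForm, eval_mul, eval_pow, eval_add, eval_C, eval_X,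
      Prod.fst_add, Prod.snd_add, Prod.smul_fst, Prod.smul_snd, smul_eq_mul]
    exact Finset.sum_congr rfl fun i _ => by ring

end Forms

section DegreeReduction

/-- A form without nontrivial zeros takes values of constant sign. -/
theorem evalForm_mul_pos_of_ne_zero {d : ℕ} {a : Fin (d + 1) → ℝ}
    (ha : ∀ v : ℝ × ℝ, v ≠ 0 → evalForm d a v ≠ 0) {v w : ℝ × ℝ} (hv : v ≠ 0) (hw : w ≠ 0) :
    0 < evalForm d a v * evalForm d a w := by
  have hc : _root_.IsPreconnected ({0}ᶜ : Set (ℝ × ℝ)) :=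
    (isConnected_compl_singleton_of_one_lt_rank (E := ℝ × ℝ) (by
      simp [one_add_one_eq_two]) 0).isPreconnected
  have hcont : Continuous (evalForm d a) := by
    have := continuous_evalForm d
    fun_prop
  have key {v w : ℝ × ℝ} (hv : v ≠ 0) (hw : w ≠ 0) (h1 : evalForm d a v ≤ 0)
      (h2 : 0 ≤ evalForm d a w) : False := by
    obtain ⟨z, hz, hz0⟩ := hc.intermediate_value hv hw hcont.continuousOn ⟨h1, h2⟩
    exact ha z hz hz0
  by_contra! h
  rcases mul_nonpos_iff.1 h with h | h
  · exact key hw hv h.2 h.1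
  · exact key hv hw h.1 h.2

open Polynomial in
/-- If `f` and `g` are forms without common nontrivial zeros whose degrees have the same parity
and `deg f ≥ deg g`, there is a form of degree `deg g` having the signs of `f` at the zeros
of `g`. -/
theorem exists_form_sign_eq {d m : ℕ} {f : Fin (d + 2 * m + 1) → ℝ} {g : Fin (d + 1) → ℝ}
    (hfg : ∀ v : ℝ × ℝ, v ≠ 0 → ¬(evalForm (d + 2 * m) f v = 0 ∧ evalForm d g v = 0)) :
    ∃ c : Fin (d + 1) → ℝ, ∀ v : ℝ × ℝ, v ≠ 0 → evalForm d g v = 0 →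
      0 < evalForm d c v * evalForm (d + 2 * m) f v := by
  by_cases hg : ∀ w, evalForm d g w = 0
  · have hf (v : ℝ × ℝ) (hv : v ≠ 0) : evalForm (d + 2 * m) f v ≠ 0 := fun h => hfg v hv ⟨h, hg v⟩
    have h0 : ((1, 0) : ℝ × ℝ) ≠ 0 := by simp
    have h1 := evalForm_mul_pos_of_ne_zero hf (v := (-1 : ℝ) • (1, 0)) (by simp) h0
    have hd : Even d := by
      by_contra hd
      rw [evalForm_homogeneous, Odd.neg_one_pow (by
        rw [Nat.not_even_iff_odd] at hd; exact hd.add_even (even_two_mul m))] at h1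
      nlinarith [mul_self_nonneg (evalForm (d + 2 * m) f (1, 0))]
    obtain ⟨k, rfl⟩ := hd
    have h2 := (isForm_normSq.pow k).smul (evalForm (k + k + 2 * m) f (1, 0))
    rw [mul_two] at h2
    obtain ⟨c, hc⟩ := h2
    refine ⟨c, fun v hv _ => ?_⟩
    rw [← hc]
    have h3 := mul_pos (evalForm_mul_pos_of_ne_zero hf h0 hv) (pow_pos (normSq_pos hv) k)
    simp only [Pi.smul_apply, Pi.pow_apply, smul_eq_mul]
    linarith
  · push Not at hg
    obtain ⟨w, hw⟩ := hg
    let u : ℝ × ℝ := (-w.2, w.1)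
    obtain ⟨F, -, -, hF⟩ := exists_polynomial_evalForm (d + 2 * m) f w u
    obtain ⟨G, hG, hGd, hG'⟩ := exists_polynomial_evalForm d g w u
    have hG0 : G ≠ 0 := by
      rintro rfl
      exact hw (by simpa using hGd.symm)
    let r := F % G
    have hr (s : ℝ) (hs : G.eval s = 0) : r.eval s = F.eval s := by
      conv_rhs => rw [← EuclideanDomain.div_add_mod F G]
      simp [hs, r]
    have hrd : r.natDegree ≤ d := (natDegree_le_natDegree (degree_mod_lt F hG0).le).trans hG
    let σ : ℝ × ℝ → ℝ := w.1 • Prod.fst + w.2 • Prod.snd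
    let τ : ℝ × ℝ → ℝ := (-w.2) • Prod.fst + w.1 • Prod.snd
    have hσ : IsForm 1 σ := (isForm_fst.smul _).add (isForm_snd.smul _)
    have hτ : IsForm 1 τ := (isForm_fst.smul _).add (isForm_snd.smul _)
    have hform : IsForm d (∑ i ∈ Finset.range (d + 1), r.coeff i • (σ ^ i * τ ^ (d - i))) := by
      refine IsForm.sum fun i hi => IsForm.smul ?_ _
      have := (hσ.pow i).mul (hτ.pow (d - i))
      rwa [mul_one, mul_one, Nat.add_sub_cancel' (Nat.le_of_lt_succ (Finset.mem_range.1 hi))]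
        at this
    obtain ⟨c, hc⟩ := hform
    refine ⟨c, fun v hv hgv => ?_⟩
    have hw0 : w ≠ 0 := by
      rintro rfl
      have h := evalForm_homogeneous d g 0 v
      simp only [zero_smul, hgv, mul_zero] at h
      exact hw h
    have hN := normSq_pos hw0
    set N := w.1 ^ 2 + w.2 ^ 2
    have hdec : N • v = σ v • w + τ v • u := by
      ext <;> simp [N, σ, τ, u] <;> ring
    have hτ0 : τ v ≠ 0 := by
      intro h
      rw [h, zero_smul, add_zero] at hdec
      have h1 := evalForm_homogeneous d g N v
      rw [hdec, evalForm_homogeneous, hgv, mul_zero] at h1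
      have h2 : σ v = 0 := by
        by_contra h2
        exact (mul_ne_zero (pow_ne_zero _ h2) hw) h1
      rw [h2, zero_smul] at hdec
      exact hv ((smul_eq_zero.1 hdec).resolve_left hN.ne')
    have hdec' : N • v = τ v • ((σ v / τ v) • w + u) := by
      rw [hdec, smul_add, smul_smul, mul_div_cancel₀ _ hτ0]
    have hGs : G.eval (σ v / τ v) = 0 := by
      have h1 := evalForm_homogeneous d g N v
      rw [hdec', evalForm_homogeneous, hgv, mul_zero, ← hG'] at h1
      exact (mul_eq_zero.1 h1).resolve_left (pow_ne_zero _ hτ0)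
    have hFs : N ^ (d + 2 * m) * evalForm (d + 2 * m) f v =
        τ v ^ (d + 2 * m) * F.eval (σ v / τ v) := by
      rw [hF, ← evalForm_homogeneous, ← evalForm_homogeneous, hdec']
    have hcs : evalForm d c v = τ v ^ d * r.eval (σ v / τ v) := by
      rw [← hc, eval_eq_sum_range' (Nat.lt_succ_of_le hrd), Finset.mul_sum, Finset.sum_apply]
      refine Finset.sum_congr rfl fun i hi => ?_
      have : τ v ^ d = τ v ^ i * τ v ^ (d - i) := by
        rw [← pow_add, Nat.add_sub_cancel' (Nat.le_of_lt_succ (Finset.mem_range.1 hi))]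
      simp only [Pi.smul_apply, Pi.mul_apply, Pi.pow_apply, smul_eq_mul, this, div_pow]
      field_simp
    rw [hr _ hGs] at hcs
    have hf0 : evalForm (d + 2 * m) f v ≠ 0 := fun h => hfg v hv ⟨h, hgv⟩
    have hFne : F.eval (σ v / τ v) ≠ 0 := by
      intro h
      rw [h, mul_zero] at hFs
      exact (mul_ne_zero (pow_ne_zero _ hN.ne') hf0) hFs
    have : 0 < N ^ (d + 2 * m) * (evalForm d c v * evalForm (d + 2 * m) f v) := by
      have h1 : N ^ (d + 2 * m) * (evalForm d c v * evalForm (d + 2 * m) f v) =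
          (τ v ^ (d + m) * F.eval (σ v / τ v)) ^ 2 := by
        rw [mul_left_comm, hFs, hcs]
        ring
      rw [h1]
      have := mul_ne_zero (pow_ne_zero (d + m) hτ0) hFne
      positivity
    exact pos_of_mul_pos_right this (pow_pos hN _).le

end DegreeReduction

section DegreeReductionEquiv

open Topology ContinuousMap

theorem NonResultantPairs.continuous_val (d₁ d₂ : ℕ) :
    Continuous fun p : NonResultantPairs d₁ d₂ => p.1 := continuous_subtype_val

theorem NonResultantPairs.homotopic_of_sign_eq {X : Type*} [TopologicalSpace X] {d₁ d₂ : ℕ}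
    {F G : C(X, NonResultantPairs d₁ d₂)} (h2 : ∀ x, (F x).1.2 = (G x).1.2)
    (h : ∀ x (v : ℝ × ℝ), v ≠ 0 → evalForm d₂ (F x).1.2 v = 0 →
      0 < evalForm d₁ (F x).1.1 v * evalForm d₁ (G x).1.1 v) : F.Homotopic G := by
  have hF := (continuous_val d₁ d₂).comp F.continuous
  have hG := (continuous_val d₁ d₂).comp G.continuous
  refine ⟨⟨⟨fun p => ⟨((1 - p.1 : ℝ) • (F p.2).1.1 + (p.1 : ℝ) • (G p.2).1.1, (F p.2).1.2),
    ?_⟩, ?_⟩, fun x => ?_, fun x => ?_⟩⟩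
  · rintro v hv ⟨h3, h4⟩
    have h5 := h p.2 v hv h4
    have ht0 := p.1.2.1
    have ht1 := p.1.2.2
    simp only [evalForm_add, evalForm_smul] at h3
    generalize evalForm d₁ (F p.2).1.1 v = α at *
    generalize evalForm d₁ (G p.2).1.1 v = β at *
    generalize (p.1 : ℝ) = t at *
    have h6 : (1 - t) * (α * α) + t * (α * β) = 0 := by linear_combination α * h3
    have h7 : (1 - t) * (α * β) + t * (β * β) = 0 := by linear_combination β * h3
    have h8 := mul_nonneg (sub_nonneg.2 ht1) (mul_self_nonneg α)
    have h9 := mul_nonneg ht0 (mul_self_nonneg β)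
    nlinarith
  · refine Continuous.subtype_mk ?_ _
    simp only [Function.comp_def] at hF hG
    fun_prop
  · exact Subtype.ext (by simp)
  · exact Subtype.ext (Prod.ext (by simp) (by simp [h2]))

/-- Over the space of non-resultant pairs, a form of degree `d₂` having the signs of the first form
at the zeros of the second one can be chosen continuously. -/
theorem exists_continuous_form_sign_eq (d m : ℕ) :
    ∃ φ : C(NonResultantPairs (d + 2 * m) d, Fin (d + 1) → ℝ), ∀ p (v : ℝ × ℝ), v ≠ 0 →
      evalForm d p.1.2 v = 0 → 0 < evalForm d (φ p) v * evalForm (d + 2 * m) p.1.1 v := by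
  have : TopologicalSpace.MetrizableSpace (NonResultantPairs (d + 2 * m) d) :=
    inferInstanceAs (TopologicalSpace.MetrizableSpace (Subtype _))
  let := TopologicalSpace.metrizableSpaceMetric (NonResultantPairs (d + 2 * m) d)
  let t : NonResultantPairs (d + 2 * m) d → Set (Fin (d + 1) → ℝ) := fun p =>
    {c | ∀ v : ℝ × ℝ, v ≠ 0 → evalForm d p.1.2 v = 0 →
      0 < evalForm d c v * evalForm (d + 2 * m) p.1.1 v}
  refine exists_continuous_forall_mem_convex_of_local_const (t := t) (fun p => ?_) fun p => ?_
  · intro a ha b hb α β hα hβ hαβ v hv hgv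
    have h1 := ha v hv hgv
    have h2 := hb v hv hgv
    rw [evalForm_add, evalForm_smul, evalForm_smul, add_mul, mul_assoc, mul_assoc]
    rcases hα.eq_or_lt with rfl | hα
    · rw [zero_add] at hαβ
      simpa [hαβ] using h2
    · have := mul_pos hα h1
      have := mul_nonneg hβ h2.le
      linarith
  · obtain ⟨c, hc⟩ := exists_form_sign_eq p.2
    refine ⟨c, ?_⟩
    have hK := isCompact_sphere (0 : ℝ × ℝ) 1
    have hcont := NonResultantPairs.continuous_val (d + 2 * m) d
    have key := hK.eventually_forall_of_forall_eventually (x₀ := p)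
      (P := fun q v => evalForm d q.1.2 v ≠ 0 ∨ 0 < evalForm d c v * evalForm (d + 2 * m) q.1.1 v)
      (fun v hv => by
        have hv0 : v ≠ 0 := by
          rintro rfl
          simp at hv
        have hO : IsOpen {z : NonResultantPairs (d + 2 * m) d × (ℝ × ℝ) |
            evalForm d z.1.1.2 z.2 ≠ 0 ∨
              0 < evalForm d c z.2 * evalForm (d + 2 * m) z.1.1.1 z.2} := by
          have h1 := continuous_evalForm d
          have h2 := continuous_evalForm (d + 2 * m)
          rw [Set.ofPred_or]
          exact (isOpen_ne_fun (by fun_prop) continuous_const).union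
            (isOpen_lt continuous_const (by fun_prop))
        refine hO.mem_nhds ?_
        by_cases h : evalForm d p.1.2 v = 0
        · exact Or.inr (hc v hv0 h)
        · exact Or.inl h)
    filter_upwards [key] with q hq v hv hgv
    have hn : (0 : ℝ) < ‖v‖⁻¹ := inv_pos.2 (norm_pos_iff.2 hv)
    have h1 := hq (‖v‖⁻¹ • v) (by simp [norm_smul, hv])
    simp only [evalForm_homogeneous, hgv, mul_zero, ne_eq, not_true_eq_false, false_or] at h1
    rw [mul_mul_mul_comm] at h1
    exact pos_of_mul_pos_right h1 (mul_pos (pow_pos hn _) (pow_pos hn _)).le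

theorem NonResultantPairs.nonempty_homotopyEquiv (d m : ℕ) :
    Nonempty (NonResultantPairs (d + 2 * m) d ≃ₕ NonResultantPairs d d) := by
  obtain ⟨φ, hφ⟩ := exists_continuous_form_sign_eq d m
  obtain ⟨L, hL, hL'⟩ := (mul_comm m 2 ▸ isForm_normSq.pow m :
    IsForm (2 * m) _).exists_continuous_mul d
  have hpos {v : ℝ × ℝ} (hv : v ≠ 0) := pow_pos (normSq_pos hv) m
  have hc := continuous_val (d + 2 * m) d
  have hc' := continuous_val d d
  let r : C(NonResultantPairs (d + 2 * m) d, NonResultantPairs d d) :=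
    ⟨fun p => ⟨(φ p, p.1.2), fun v hv h => by
      have := hφ p v hv h.2
      simp [h.1] at this⟩, Continuous.subtype_mk (by fun_prop) _⟩
  let i : C(NonResultantPairs d d, NonResultantPairs (d + 2 * m) d) :=
    ⟨fun p => ⟨(L p.1.1, p.1.2), fun v hv h => p.2 v hv ⟨by
      have := h.1
      rw [hL'] at this
      exact (mul_eq_zero.1 this).resolve_right (hpos hv).ne', h.2⟩⟩,
      Continuous.subtype_mk (by fun_prop) _⟩
  refine ⟨⟨r, i, ?_, ?_⟩⟩
  · refine homotopic_of_sign_eq (fun x => rfl) fun x v hv h => ?_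
    have h1 := mul_pos (hφ x v hv h) (hpos hv)
    have h2 : evalForm (d + 2 * m) ((i.comp r) x).1.1 v = evalForm d (φ x) v * _ := hL' _ v
    rw [h2]
    exact h1.trans_eq (by simp; ring)
  · refine homotopic_of_sign_eq (fun x => rfl) fun x v hv h => ?_
    have h1 := hφ (i x) v hv h
    have h2 : evalForm (d + 2 * m) (i x).1.1 v = evalForm d x.1.1 v * _ := hL' _ v
    rw [h2, ← mul_assoc] at h1
    exact pos_of_mul_pos_left h1 (hpos hv).le

end DegreeReductionEquiv

section CircleModel

open Polynomial ComplexConjugate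

/-- Coefficient vectors of complex polynomials of degree at most `d` without zeros on the
unit circle. -/
def circleFree (d : ℕ) : Set (Fin (d + 1) → ℂ) :=
  {b | ∀ z : ℂ, ‖z‖ = 1 → ∑ i, b i * z ^ (i : ℕ) ≠ 0}

/-- The monomial `x ^ (d - j) * y ^ j` on the circle, in the variable
`z = (x + iy) / (x - iy)` and up to a factor `(x - iy) ^ d`. -/
noncomputable def circleMonomial (d : ℕ) (j : Fin (d + 1)) : ℂ[X] :=
  (C (1 / 2) * X + C (1 / 2)) ^ (d - (j : ℕ)) *
    (C (1 / (2 * Complex.I)) * X + C (-1 / (2 * Complex.I))) ^ (j : ℕ)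

theorem natDegree_circleMonomial_le (d : ℕ) (j : Fin (d + 1)) :
    (circleMonomial d j).natDegree ≤ d := by
  unfold circleMonomial
  compute_degree
  omega

theorem conj_pow_mul_eval_circleMonomial (d : ℕ) (j : Fin (d + 1)) {ζ : ℂ} (hζ : ζ ≠ 0) :
    conj ζ ^ d * (circleMonomial d j).eval (ζ / conj ζ) =
      (ζ.re : ℂ) ^ (d - (j : ℕ)) * (ζ.im : ℂ) ^ (j : ℕ) := by
  have h0 : conj ζ ≠ 0 := (_root_.map_ne_zero _).2 hζ
  have h1 : conj ζ * (1 / 2 * (ζ / conj ζ) + 1 / 2) = ζ.re := by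
    rw [Complex.re_eq_add_conj]
    field_simp
  have h2 : conj ζ * (1 / (2 * Complex.I) * (ζ / conj ζ) + -1 / (2 * Complex.I)) = ζ.im := by
    rw [Complex.im_eq_sub_conj]
    field_simp
    ring
  have h3 : conj ζ ^ d = conj ζ ^ (d - (j : ℕ)) * conj ζ ^ (j : ℕ) := by
    rw [← pow_add, Nat.sub_add_cancel (Nat.le_of_lt_succ j.2)]
  simp only [circleMonomial, eval_mul, eval_pow, eval_add, eval_C, eval_X]
  rw [h3, mul_mul_mul_comm, ← mul_pow, ← mul_pow, h1, h2]

/-- The change of variables from complex valued binary forms on `ℝ²` to polynomials in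
`z = (x + iy) / (x - iy)`, on coefficients. -/
noncomputable def circleTransform (d : ℕ) : (Fin (d + 1) → ℂ) →ₗ[ℂ] (Fin (d + 1) → ℂ) :=
  Fintype.linearCombination ℂ fun j i => (circleMonomial d j).coeff i

theorem conj_pow_mul_sum_circleTransform (d : ℕ) (a : Fin (d + 1) → ℂ) {ζ : ℂ} (hζ : ζ ≠ 0) :
    conj ζ ^ d * ∑ i, circleTransform d a i * (ζ / conj ζ) ^ (i : ℕ) =
      evalForm d (fun j => (a j).re) (ζ.re, ζ.im) +
        evalForm d (fun j => (a j).im) (ζ.re, ζ.im) * Complex.I := by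
  have h (z : ℂ) : ∑ i, circleTransform d a i * z ^ (i : ℕ) =
      ∑ j, a j * (circleMonomial d j).eval z := by
    simp only [circleTransform, Fintype.linearCombination_apply, Finset.sum_apply, Pi.smul_apply,
      smul_eq_mul, Finset.sum_mul]
    rw [Finset.sum_comm]
    refine Finset.sum_congr rfl fun j _ => ?_
    rw [eval_eq_sum_range' (Nat.lt_succ_of_le (natDegree_circleMonomial_le d j)),
      ← Fin.sum_univ_eq_sum_range (fun i => (circleMonomial d j).coeff i * z ^ i), Finset.mul_sum]
    simp only [mul_assoc]
  rw [h, Finset.mul_sum]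
  simp only [evalForm, Complex.ofReal_sum, Finset.sum_mul, ← Finset.sum_add_distrib]
  refine Finset.sum_congr rfl fun j _ => ?_
  rw [mul_left_comm, conj_pow_mul_eval_circleMonomial d j hζ]
  conv_lhs => rw [← Complex.re_add_im (a j)]
  push_cast
  ring

theorem exists_div_conj_eq {z : ℂ} (hz : ‖z‖ = 1) : ∃ ζ : ℂ, ζ ≠ 0 ∧ ζ / conj ζ = z := by
  obtain ⟨ζ, hζ⟩ := IsAlgClosed.exists_pow_nat_eq z two_pos
  have h1 : ‖ζ‖ = 1 := by
    rw [← hζ, norm_pow] at hz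
    exact (pow_eq_one_iff_of_nonneg (norm_nonneg _) two_ne_zero).1 hz
  refine ⟨ζ, norm_ne_zero_iff.1 (by simp [h1]), ?_⟩
  rw [← Complex.inv_eq_conj h1, div_inv_eq_mul, ← sq, hζ]

theorem eq_zero_of_evalForm_eq_zero {d : ℕ} {a : Fin (d + 1) → ℝ}
    (h : ∀ v : ℝ × ℝ, v ≠ 0 → evalForm d a v = 0) : a = 0 := by
  have h1 : (∑ i : Fin (d + 1), Polynomial.monomial (i : ℕ) (a i)) = 0 := by
    refine Polynomial.funext fun y => ?_
    have := h (1, y) (by simp)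
    simpa [evalForm, eval_finsetSum] using this
  funext i
  have h2 := congrArg (fun p => p.coeff (i : ℕ)) h1
  simpa [finsetSum_coeff, coeff_monomial, Fin.val_inj] using h2

theorem circleTransform_injective (d : ℕ) : Function.Injective (circleTransform d) := by
  rw [injective_iff_map_eq_zero]
  intro a ha
  have key (v : ℝ × ℝ) (hv : v ≠ 0) : evalForm d (fun j => (a j).re) v = 0 ∧
      evalForm d (fun j => (a j).im) v = 0 := by
    have hζ : (⟨v.1, v.2⟩ : ℂ) ≠ 0 := fun h => hv (Prod.ext (congrArg Complex.re h)
      (congrArg Complex.im h))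
    have h := conj_pow_mul_sum_circleTransform d a hζ
    simp only [ha, Pi.zero_apply, zero_mul, Finset.sum_const_zero, mul_zero] at h
    exact ⟨by simpa using (congrArg Complex.re h).symm, by simpa using (congrArg Complex.im h).symm⟩
  have h1 := eq_zero_of_evalForm_eq_zero fun v hv => (key v hv).1
  have h2 := eq_zero_of_evalForm_eq_zero fun v hv => (key v hv).2
  exact _root_.funext fun j => Complex.ext (congrFun h1 j) (congrFun h2 j)

/-- Pairs of real vectors as complex vectors. -/
noncomputable def realPairHomeomorph (n : ℕ) : (Fin n → ℝ) × (Fin n → ℝ) ≃ₜ (Fin n → ℂ) where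
  toFun p i := ⟨p.1 i, p.2 i⟩
  invFun a := (fun i => (a i).re, fun i => (a i).im)
  left_inv _ := rfl
  right_inv _ := rfl
  continuous_toFun := continuous_pi fun i =>
    Complex.equivRealProdCLM.symm.continuous.comp
      (f := fun p : (Fin n → ℝ) × (Fin n → ℝ) => (p.1 i, p.2 i)) (by fun_prop)
  continuous_invFun := by fun_prop

theorem circleTransform_mem_circleFree_iff {d : ℕ} (p : (Fin (d + 1) → ℝ) × (Fin (d + 1) → ℝ)) :
    circleTransform d (realPairHomeomorph (d + 1) p) ∈ circleFree d ↔
      ∀ v : ℝ × ℝ, v ≠ 0 → ¬(evalForm d p.1 v = 0 ∧ evalForm d p.2 v = 0) := by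
  have hz {ζ : ℂ} (hζ : ζ ≠ 0) : ∑ i, circleTransform d (realPairHomeomorph (d + 1) p) i *
      (ζ / conj ζ) ^ (i : ℕ) = 0 ↔
        evalForm d p.1 (ζ.re, ζ.im) = 0 ∧ evalForm d p.2 (ζ.re, ζ.im) = 0 := by
    have h := conj_pow_mul_sum_circleTransform d (realPairHomeomorph (d + 1) p) hζ
    have h0 : conj ζ ^ d ≠ 0 := pow_ne_zero _ ((_root_.map_ne_zero _).2 hζ)
    rw [← mul_right_inj' h0, h, mul_zero, Complex.ext_iff]
    simp [realPairHomeomorph]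
  generalize circleTransform d (realPairHomeomorph (d + 1) p) = b at hz
  constructor
  · rintro h ⟨x, y⟩ hv hv0
    obtain ⟨ζ, rfl, rfl⟩ : ∃ ζ : ℂ, ζ.re = x ∧ ζ.im = y := ⟨⟨x, y⟩, rfl, rfl⟩
    have hζ : ζ ≠ 0 := by
      rintro rfl
      exact hv rfl
    have h1 := (hz hζ).2 hv0
    refine h (ζ / conj ζ) ?_ h1
    rw [norm_div, RCLike.norm_conj, div_self (norm_ne_zero_iff.2 hζ)]
  · intro h z hz1 h0
    obtain ⟨ζ, hζ, rfl⟩ := exists_div_conj_eq hz1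
    exact h _ (fun h' => hζ (Complex.ext (congrArg Prod.fst h') (congrArg Prod.snd h')))
      ((hz hζ).1 h0)

/-- Non-resultant pairs of forms of the same degree as polynomials without zeros on the circle. -/
noncomputable def nonResultantPairsHomeomorph (d : ℕ) :
    NonResultantPairs d d ≃ₜ circleFree d :=
  ((realPairHomeomorph (d + 1)).trans (LinearEquiv.ofInjectiveEndo (circleTransform d)
    (circleTransform_injective d)).toContinuousLinearEquiv.toHomeomorph).subtype fun p =>
      (circleTransform_mem_circleFree_iff p).symm

end CircleModel

section RootParametrization

open Polynomial Topology

theorem isProperMap_smul_of_ne_zero {K E : Type*} [TopologicalSpace K] [CompactSpace K]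
    [NormedAddCommGroup E] [NormedSpace ℂ E] [ProperSpace E] {F : K → E} (hF : Continuous F)
    (h0 : ∀ x, F x ≠ 0) : IsProperMap fun p : ℂ × K => p.1 • F p.2 := by
  have hc : Continuous fun p : ℂ × K => p.1 • F p.2 := by fun_prop
  obtain ⟨ε, hε, hεF⟩ : ∃ ε > 0, ∀ x, ε ≤ ‖F x‖ := by
    rcases isEmpty_or_nonempty K with hK | hK
    · exact ⟨1, one_pos, fun x => hK.elim x⟩
    · obtain ⟨x, -, hx⟩ := isCompact_univ.exists_isMinOn Set.univ_nonempty hF.norm.continuousOn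
      exact ⟨‖F x‖, norm_pos_iff.2 (h0 x), fun y => hx (Set.mem_univ y)⟩
  refine isProperMap_iff_isCompact_preimage.2 ⟨hc, fun S hS => ?_⟩
  obtain ⟨R, hR⟩ := hS.isBounded.exists_norm_le
  refine ((isCompact_closedBall (0 : ℂ) (R / ε)).prod isCompact_univ).of_isClosed_subset
    (hS.isClosed.preimage hc) fun p hp => ⟨?_, trivial⟩
  have h1 := hR _ hp
  rw [norm_smul] at h1
  rw [mem_closedBall_zero_iff, le_div_iff₀ hε]
  exact (mul_le_mul_of_nonneg_left (hεF _) (norm_nonneg _)).trans h1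

theorem continuous_coeff_mul {Z : Type*} [TopologicalSpace Z] {p q : Z → ℂ[X]}
    (hp : ∀ n, Continuous fun z => (p z).coeff n) (hq : ∀ n, Continuous fun z => (q z).coeff n)
    (n : ℕ) : Continuous fun z => (p z * q z).coeff n := by
  simp only [coeff_mul]
  fun_prop

theorem continuous_coeff_prod {Z ι : Type*} [TopologicalSpace Z] {p : ι → Z → ℂ[X]}
    (s : Finset ι) (hp : ∀ i n, Continuous fun z => (p i z).coeff n) (n : ℕ) :
    Continuous fun z => (∏ i ∈ s, p i z).coeff n := by
  classical
  induction s using Finset.induction_on generalizing n with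
  | empty => simpa using continuous_const
  | insert i s hi ih =>
    simp only [Finset.prod_insert hi]
    exact continuous_coeff_mul (hp i) ih n

/-- The closed unit disc. -/
abbrev ClosedDisc : Type := Metric.closedBall (0 : ℂ) 1

/-- The polynomial with leading parameter `c`, with inner zeros `a i` and with
outer zeros `1 / b j`. -/
noncomputable def rootPoly {k l : ℕ} (w : ℂ × (Fin k → ClosedDisc) × (Fin l → ClosedDisc)) :
    ℂ[X] :=
  C w.1 * ((∏ i, (X - C (w.2.1 i : ℂ))) * ∏ j, (1 - C (w.2.2 j : ℂ) * X))

/-- The first `d + 1` coefficients of a polynomial. -/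
noncomputable def coeffVec (d : ℕ) (p : ℂ[X]) : Fin (d + 1) → ℂ := fun i => p.coeff i

/-- The polynomial with a given vector of coefficients. -/
noncomputable def vecPoly {d : ℕ} (b : Fin (d + 1) → ℂ) : ℂ[X] :=
  ∑ i : Fin (d + 1), monomial (i : ℕ) (b i)

theorem natDegree_vecPoly_le {d : ℕ} (b : Fin (d + 1) → ℂ) : (vecPoly b).natDegree ≤ d :=
  natDegree_sum_le_of_forall_le _ _ fun i _ =>
    (natDegree_monomial_le _).trans (Nat.le_of_lt_succ i.2)

theorem coeffVec_vecPoly {d : ℕ} (b : Fin (d + 1) → ℂ) : coeffVec d (vecPoly b) = b := by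
  funext i
  simp [coeffVec, vecPoly, finsetSum_coeff, coeff_monomial, Fin.val_inj]

theorem vecPoly_coeffVec {d : ℕ} {p : ℂ[X]} (hp : p.natDegree ≤ d) :
    vecPoly (coeffVec d p) = p := by
  conv_rhs => rw [p.as_sum_range' (d + 1) (Nat.lt_succ_of_le hp)]
  exact Fin.sum_univ_eq_sum_range (fun i => monomial i (p.coeff i)) (d + 1)

theorem eval_vecPoly {d : ℕ} (b : Fin (d + 1) → ℂ) (z : ℂ) :
    (vecPoly b).eval z = ∑ i, b i * z ^ (i : ℕ) := by
  simp [vecPoly, eval_finsetSum]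

theorem mem_circleFree_iff {d : ℕ} {b : Fin (d + 1) → ℂ} :
    b ∈ circleFree d ↔ ∀ z : ℂ, ‖z‖ = 1 → (vecPoly b).eval z ≠ 0 := by
  simp only [eval_vecPoly]
  rfl

theorem natDegree_rootPoly_le {k l : ℕ} (w : ℂ × (Fin k → ClosedDisc) × (Fin l → ClosedDisc)) :
    (rootPoly w).natDegree ≤ k + l := by
  refine (natDegree_C_mul_le _ _).trans (natDegree_mul_le_of_le ?_ ?_)
  · simp
  · refine (natDegree_prod_le _ _).trans ((Finset.sum_le_card_nsmul _ _ 1 fun j _ => ?_).trans ?_)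
    · compute_degree
    · simp

theorem one_sub_C_mul_X_ne_zero (b : ℂ) : (1 - C b * X : ℂ[X]) ≠ 0 := by
  intro h
  simpa using congrArg (eval 0) h

theorem rootPoly_ne_zero {k l : ℕ} {w : ℂ × (Fin k → ClosedDisc) × (Fin l → ClosedDisc)}
    (hw : w.1 ≠ 0) : rootPoly w ≠ 0 :=
  mul_ne_zero (C_ne_zero.2 hw) (mul_ne_zero (Finset.prod_ne_zero_iff.2 fun _ _ => X_sub_C_ne_zero _)
    (Finset.prod_ne_zero_iff.2 fun _ _ => one_sub_C_mul_X_ne_zero _))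

/-- Coefficients of the polynomial with given inner and outer zeros. -/
noncomputable def rootCoeff (d : ℕ) {k l : ℕ}
    (w : ℂ × (Fin k → ClosedDisc) × (Fin l → ClosedDisc)) : Fin (d + 1) → ℂ :=
  coeffVec d (rootPoly w)

theorem vecPoly_rootCoeff {d k l : ℕ} (hd : k + l = d)
    (w : ℂ × (Fin k → ClosedDisc) × (Fin l → ClosedDisc)) :
    vecPoly (rootCoeff d w) = rootPoly w :=
  vecPoly_coeffVec ((natDegree_rootPoly_le w).trans_eq hd)

theorem isProperMap_rootCoeff {d k l : ℕ} (hd : k + l = d) :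
    IsProperMap (rootCoeff d : ℂ × (Fin k → ClosedDisc) × (Fin l → ClosedDisc) → _) := by
  have hcoeff (n : ℕ) : Continuous fun κ : (Fin k → ClosedDisc) × (Fin l → ClosedDisc) =>
      (rootPoly (1, κ)).coeff n := by
    simp only [rootPoly, C_1, one_mul]
    refine continuous_coeff_mul (continuous_coeff_prod _ fun i n => ?_)
      (continuous_coeff_prod _ fun i n => ?_) n
    · simp only [coeff_sub, coeff_C]
      split_ifs <;> fun_prop
    · simp only [coeff_sub, coeff_C_mul]
      fun_prop
  have h := isProperMap_smul_of_ne_zero (K := (Fin k → ClosedDisc) × (Fin l → ClosedDisc))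
    (F := fun κ => rootCoeff d (1, κ)) (continuous_pi fun i => hcoeff i) fun κ h0 => by
      apply rootPoly_ne_zero (w := (1, κ)) one_ne_zero
      rw [← vecPoly_rootCoeff hd, h0]
      simp [vecPoly]
  have heq : (rootCoeff d : ℂ × (Fin k → ClosedDisc) × (Fin l → ClosedDisc) → _) =
      fun p => p.1 • rootCoeff d (1, p.2) := by
    funext w i
    simp [rootCoeff, coeffVec, rootPoly]
  rw [heq]
  exact h

/-- The zeros of a polynomial in the open unit disc. -/
noncomputable def innerRoots {d : ℕ} (b : Fin (d + 1) → ℂ) : Multiset ℂ :=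
  (vecPoly b).roots.filter fun z => ‖z‖ < 1

theorem card_innerRoots_le {d : ℕ} (b : Fin (d + 1) → ℂ) : (innerRoots b).card ≤ d :=
  (Multiset.card_le_card (Multiset.filter_le _ _)).trans
    ((card_roots' _).trans (natDegree_vecPoly_le b))

theorem eval_rootPoly {k l : ℕ} (w : ℂ × (Fin k → ClosedDisc) × (Fin l → ClosedDisc)) (z : ℂ) :
    (rootPoly w).eval z = w.1 * ((∏ i, (z - w.2.1 i)) * ∏ j, (1 - w.2.2 j * z)) := by
  simp [rootPoly, eval_prod]

theorem rootCoeff_mem_circleFree_iff {d k l : ℕ} (hd : k + l = d)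
    {w : ℂ × (Fin k → ClosedDisc) × (Fin l → ClosedDisc)} :
    rootCoeff d w ∈ circleFree d ↔
      w.1 ≠ 0 ∧ (∀ i, ‖(w.2.1 i : ℂ)‖ < 1) ∧ ∀ j, ‖(w.2.2 j : ℂ)‖ < 1 := by
  simp only [mem_circleFree_iff, vecPoly_rootCoeff hd, eval_rootPoly]
  constructor
  · intro h
    refine ⟨?_, fun i => lt_of_le_of_ne (mem_closedBall_zero_iff.1 (w.2.1 i).2) fun hi => ?_,
      fun j => lt_of_le_of_ne (mem_closedBall_zero_iff.1 (w.2.2 j).2) fun hj => ?_⟩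
    · intro h0
      exact h 1 (by simp) (by simp [h0])
    · refine h _ hi ?_
      rw [Finset.prod_eq_zero (Finset.mem_univ i) (sub_self _), zero_mul, mul_zero]
    · refine h (w.2.2 j : ℂ)⁻¹ (by rw [norm_inv, hj, inv_one]) ?_
      rw [Finset.prod_eq_zero (i := j) (s := Finset.univ) (f := fun j => 1 - (w.2.2 j : ℂ) * _)
        (Finset.mem_univ j), mul_zero, mul_zero]
      rw [mul_inv_cancel₀ (norm_ne_zero_iff.1 (by rw [hj]; exact one_ne_zero)), sub_self]
  · rintro ⟨h0, ha, hb⟩ z hz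
    refine mul_ne_zero h0 (mul_ne_zero (Finset.prod_ne_zero_iff.2 fun i _ h => ?_)
      (Finset.prod_ne_zero_iff.2 fun j _ h => ?_))
    · have := ha i
      rw [← sub_eq_zero.1 h, hz] at this
      exact this.false
    · have := congrArg norm (sub_eq_zero.1 h)
      rw [norm_mul, hz, mul_one, norm_one] at this
      exact (hb j).ne this.symm

theorem innerRoots_rootCoeff {d k l : ℕ} (hd : k + l = d)
    {w : ℂ × (Fin k → ClosedDisc) × (Fin l → ClosedDisc)} (hw : rootCoeff d w ∈ circleFree d) :
    innerRoots (rootCoeff d w) = Finset.univ.val.map fun i => (w.2.1 i : ℂ) := by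
  obtain ⟨h0, ha, hb⟩ := (rootCoeff_mem_circleFree_iff hd).1 hw
  have hA : (∏ i, (X - C (w.2.1 i : ℂ))) ≠ 0 :=
    Finset.prod_ne_zero_iff.2 fun _ _ => X_sub_C_ne_zero _
  have hB : (∏ j, (1 - C (w.2.2 j : ℂ) * X)) ≠ 0 :=
    Finset.prod_ne_zero_iff.2 fun _ _ => one_sub_C_mul_X_ne_zero _
  rw [innerRoots, vecPoly_rootCoeff hd, rootPoly, roots_C_mul _ h0, roots_mul (mul_ne_zero hA hB),
    Multiset.filter_add]
  have h1 : (∏ i, (X - C (w.2.1 i : ℂ))).roots = Finset.univ.val.map fun i => (w.2.1 i : ℂ) := by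
    have := roots_multiset_prod_X_sub_C (Finset.univ.val.map fun i => (w.2.1 i : ℂ))
    rwa [Multiset.map_map] at this
  rw [h1, Multiset.filter_eq_self.2, Multiset.filter_eq_nil.2, add_zero]
  · intro z hz hz1
    rw [mem_roots hB, IsRoot, eval_prod, Finset.prod_eq_zero_iff] at hz
    obtain ⟨j, -, hj⟩ := hz
    simp only [eval_sub, eval_one, eval_mul, eval_C, eval_X] at hj
    have := congrArg norm (sub_eq_zero.1 hj)
    rw [norm_mul, norm_one] at this
    have h2 := mul_lt_one_of_nonneg_of_lt_one_left (norm_nonneg _) (hb j) hz1.le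
    exact h2.ne this.symm
  · intro z hz
    obtain ⟨i, -, rfl⟩ := Multiset.mem_map.1 hz
    exact ha i

end RootParametrization

section RootScaling

open Polynomial Topology

section ProperQuotient

open scoped ContinuousMap

/-- Homotopy equivalence out of the target of a proper surjection, from a deformation of the
source compatible with the fibres. -/
theorem nonempty_homotopyEquiv_of_isProperMap {W Y B : Type*} [TopologicalSpace W]
    [TopologicalSpace Y] [TopologicalSpace B] {q : W → Y} (hq : IsProperMap q)
    (hsurj : Function.Surjective q) (c : C(W, B)) (s : C(B, W)) (hcs : ∀ x, c (s x) = x)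
    (h : C(unitInterval × W, W)) (h0 : ∀ w, h (0, w) = s (c w)) (h1 : ∀ w, h (1, w) = w)
    (hc : ∀ w w', q w = q w' → c w = c w')
    (hh : ∀ w w', q w = q w' → ∀ t, q (h (t, w)) = q (h (t, w'))) : Nonempty (Y ≃ₕ B) := by
  have hq1 : IsQuotientMap (⟨q, hq.continuous⟩ : C(W, Y)) :=
    hq.isClosedMap.isQuotientMap hq.continuous hsurj
  have hq2 : IsQuotientMap (⟨Prod.map id q, continuous_id.prodMap hq.continuous⟩ :
      C(unitInterval × W, unitInterval × Y)) :=
    (isProperMap_id.prodMap hq).isClosedMap.isQuotientMap (continuous_id.prodMap hq.continuous)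
      (Function.surjective_id.prodMap hsurj)
  let f : C(Y, B) := hq1.lift c hc
  have hf (w : W) : f (q w) = c w := DFunLike.congr_fun (hq1.lift_comp c hc) w
  have hcq := hq.continuous
  let g : C(unitInterval × W, Y) := ⟨fun p => q (h p), by fun_prop⟩
  have hg : Function.FactorsThrough g (Prod.map id q) := by
    rintro ⟨t, w⟩ ⟨t', w'⟩ heq
    obtain ⟨rfl, h2⟩ := Prod.ext_iff.1 heq
    exact hh w w' h2 t
  let H : C(unitInterval × Y, Y) := hq2.lift g hg
  have hH (t : unitInterval) (w : W) : H (t, q w) = q (h (t, w)) :=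
    DFunLike.congr_fun (hq2.lift_comp g hg) (t, w)
  refine ⟨⟨f, (⟨q, hcq⟩ : C(W, Y)).comp s, ⟨⟨H, fun y => ?_, fun y => ?_⟩⟩, ?_⟩⟩
  · obtain ⟨w, rfl⟩ := hsurj y
    simp [hH, h0, hf]
  · obtain ⟨w, rfl⟩ := hsurj y
    simp [hH, h1]
  · have : f.comp ((⟨q, hcq⟩ : C(W, Y)).comp s) = ContinuousMap.id B := by
      ext x
      simp [hf, hcs]
    rw [this]

end ProperQuotient

/-- Scaling of the closed disc. -/
noncomputable def scaleDisc (t : unitInterval) (a : ClosedDisc) : ClosedDisc :=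
  ⟨(t : ℝ) * a, by
    rw [mem_closedBall_zero_iff, norm_mul, Complex.norm_real, Real.norm_of_nonneg t.2.1]
    exact mul_le_one₀ t.2.2 (norm_nonneg _) (mem_closedBall_zero_iff.1 a.2)⟩

theorem norm_scaleDisc_lt_one (t : unitInterval) {a : ClosedDisc} (ha : ‖(a : ℂ)‖ < 1) :
    ‖(scaleDisc t a : ℂ)‖ < 1 := by
  rw [scaleDisc, norm_mul, Complex.norm_real, Real.norm_of_nonneg t.2.1]
  exact mul_lt_one_of_nonneg_of_lt_one_right t.2.2 (norm_nonneg _) ha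

@[fun_prop]
theorem continuous_scaleDisc :
    Continuous fun p : unitInterval × ClosedDisc => scaleDisc p.1 p.2 :=
  Continuous.subtype_mk (by fun_prop) _

/-- Scaling of the inner and outer zeros. -/
noncomputable def scaleParam {k l : ℕ} (t : unitInterval)
    (w : ℂ × (Fin k → ClosedDisc) × (Fin l → ClosedDisc)) :
    ℂ × (Fin k → ClosedDisc) × (Fin l → ClosedDisc) :=
  (w.1, fun i => scaleDisc t (w.2.1 i), fun j => scaleDisc t (w.2.2 j))

theorem rootPoly_scaleParam {k l : ℕ} (t : unitInterval)
    (w : ℂ × (Fin k → ClosedDisc) × (Fin l → ClosedDisc)) :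
    rootPoly (scaleParam t w) = C w.1 *
      ((((Finset.univ.val.map fun i => (w.2.1 i : ℂ)).map
        fun z => X - C (((t : ℝ) : ℂ) * z)).prod) *
        (∏ j, (1 - C (w.2.2 j : ℂ) * X)).comp (C ((t : ℝ) : ℂ) * X)) := by
  simp only [rootPoly, scaleParam, scaleDisc, Multiset.map_map, Polynomial.prod_comp]
  congr 2
  refine Finset.prod_congr rfl fun j _ => ?_
  simp
  ring

theorem rootPoly_eq {k l : ℕ} (w : ℂ × (Fin k → ClosedDisc) × (Fin l → ClosedDisc)) :
    rootPoly w = C w.1 *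
      ((((Finset.univ.val.map fun i => (w.2.1 i : ℂ)).map fun z => X - C z).prod) *
        (∏ j, (1 - C (w.2.2 j : ℂ) * X))) := by
  rw [rootPoly, Multiset.map_map]
  rfl

/-- The parameters are determined by the coefficients, up to permutation of the zeros. -/
theorem rootCoeff_eq_rootCoeff {d k l : ℕ} (hd : k + l = d)
    {w w' : ℂ × (Fin k → ClosedDisc) × (Fin l → ClosedDisc)} (hw : rootCoeff d w ∈ circleFree d)
    (h : rootCoeff d w = rootCoeff d w') : w.1 = w'.1 ∧
      (Finset.univ.val.map fun i => (w.2.1 i : ℂ)) = (Finset.univ.val.map fun i => (w'.2.1 i : ℂ)) ∧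
      ∏ j, (1 - C (w.2.2 j : ℂ) * X) = ∏ j, (1 - C (w'.2.2 j : ℂ) * X) := by
  have hw' : rootCoeff d w' ∈ circleFree d := h ▸ hw
  have hA : (Finset.univ.val.map fun i => (w.2.1 i : ℂ)) =
      (Finset.univ.val.map fun i => (w'.2.1 i : ℂ)) := by
    rw [← innerRoots_rootCoeff hd hw, ← innerRoots_rootCoeff hd hw', h]
  have hP : rootPoly w = rootPoly w' := by
    rw [← vecPoly_rootCoeff hd w, h, vecPoly_rootCoeff hd w']
  rw [rootPoly_eq, rootPoly_eq, hA, mul_left_comm, mul_left_comm (C w'.1)] at hP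
  have hne : ((Finset.univ.val.map fun i => (w'.2.1 i : ℂ)).map fun z => X - C z).prod ≠ 0 :=
    (monic_multiset_prod_of_monic _ _ fun z _ => monic_X_sub_C z).ne_zero
  have hB := mul_left_cancel₀ hne hP
  have hc : w.1 = w'.1 := by
    simpa [eval_prod] using congrArg (eval 0) hB
  refine ⟨hc, hA, ?_⟩
  rw [hc] at hB
  exact mul_left_cancel₀ (C_ne_zero.2 ((rootCoeff_mem_circleFree_iff hd).1 hw').1) hB

theorem rootCoeff_scaleParam_eq {d k l : ℕ} (hd : k + l = d)
    {w w' : ℂ × (Fin k → ClosedDisc) × (Fin l → ClosedDisc)} (hw : rootCoeff d w ∈ circleFree d)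
    (h : rootCoeff d w = rootCoeff d w') (t : unitInterval) :
    rootCoeff d (scaleParam t w) = rootCoeff d (scaleParam t w') := by
  obtain ⟨h1, h2, h3⟩ := rootCoeff_eq_rootCoeff hd hw h
  rw [rootCoeff, rootCoeff, rootPoly_scaleParam, rootPoly_scaleParam, h1, h2, h3]

theorem exists_disc_map_eq {n : ℕ} {s : Multiset ℂ} (hs : s.card = n) (h : ∀ z ∈ s, ‖z‖ ≤ 1) :
    ∃ a : Fin n → ClosedDisc, (Finset.univ.val.map fun i => (a i : ℂ)) = s := by
  subst hs
  obtain ⟨L, rfl⟩ := Quotient.exists_rep s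
  refine ⟨fun i => ⟨L.get i, mem_closedBall_zero_iff.2 (h _ (L.get_mem i))⟩, ?_⟩
  exact (Fin.univ_val_map _).trans (congrArg _ (List.ofFn_get L))

theorem exists_rootCoeff_eq {d k l : ℕ} (hd : k + l = d) {b : Fin (d + 1) → ℂ}
    (hb : b ∈ circleFree d) (hk : (innerRoots b).card = k) :
    ∃ w : ℂ × (Fin k → ClosedDisc) × (Fin l → ClosedDisc), rootCoeff d w = b := by
  rw [mem_circleFree_iff] at hb
  let p := vecPoly b
  let out := p.roots.filter fun z => ¬ ‖z‖ < 1
  have hp : p ≠ 0 := by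
    intro h
    exact hb 1 (by simp) (by change p.eval 1 = 0; rw [h, eval_zero])
  have hout (z : ℂ) (hz : z ∈ out) : 1 < ‖z‖ := by
    obtain ⟨h1, h2⟩ := Multiset.mem_filter.1 hz
    refine lt_of_le_of_ne (not_lt.1 h2) fun h => hb z h.symm ?_
    exact (mem_roots hp).1 h1
  have hsplit : innerRoots b + out = p.roots := Multiset.filter_add_not _ _
  have hcard : out.card ≤ l := by
    have h1 := congrArg Multiset.card hsplit
    rw [Multiset.card_add, hk] at h1
    have h2 : p.roots.card ≤ d := (card_roots' _).trans (natDegree_vecPoly_le b)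
    omega
  obtain ⟨a, ha⟩ := exists_disc_map_eq hk fun z hz => (Multiset.mem_filter.1 hz).2.le
  obtain ⟨β, hβ⟩ := exists_disc_map_eq (n := l)
    (s := out.map (·⁻¹) + Multiset.replicate (l - out.card) 0)
    (by simp; omega) fun z hz => by
      rcases Multiset.mem_add.1 hz with hz | hz
      · obtain ⟨y, hy, rfl⟩ := Multiset.mem_map.1 hz
        rw [norm_inv]
        exact inv_le_one_of_one_le₀ (hout y hy).le
      · simp [Multiset.eq_of_mem_replicate hz]
  have hB : ∏ j, (1 - C (β j : ℂ) * X) = (out.map fun z => 1 - C z⁻¹ * X).prod := by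
    have h1 : ∏ j, (1 - C (β j : ℂ) * X) =
        ((Finset.univ.val.map fun j => (β j : ℂ)).map fun z => 1 - C z * X).prod := by
      rw [Multiset.map_map]
      rfl
    rw [h1, hβ]
    simp
  have hX : (out.map fun z => X - C z).prod =
      C (out.map fun z => -z).prod * (out.map fun z => 1 - C z⁻¹ * X).prod := by
    rw [map_multiset_prod, Multiset.map_map, ← Multiset.prod_map_mul]
    refine congrArg Multiset.prod (Multiset.map_congr rfl fun z hz => ?_)
    have hz0 : z ≠ 0 := by
      rintro rfl
      have := hout 0 hz
      norm_num at this
    rw [Function.comp_apply, mul_sub, ← mul_assoc, ← C_mul, neg_mul, mul_inv_cancel₀ hz0]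
    simp
    ring
  refine ⟨(p.leadingCoeff * (out.map fun z => -z).prod, a, β), ?_⟩
  rw [← coeffVec_vecPoly b, rootCoeff, rootPoly_eq, ha, hB]
  have h2 : p = C p.leadingCoeff * (p.roots.map fun z => X - C z).prod :=
    (IsAlgClosed.splits p).eq_prod_roots
  refine congrArg (coeffVec d) (Eq.trans ?_ h2.symm)
  rw [← hsplit, Multiset.map_add, Multiset.prod_add, hX, C_mul]
  ring

end RootScaling

section InnerCount

open Polynomial Topology
open scoped ContinuousMap

theorem continuous_of_isClosed_fibres {X ι : Type*} [TopologicalSpace X] [TopologicalSpace ι]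
    [DiscreteTopology ι] [Finite ι] {f : X → ι} (h : ∀ k, IsClosed (f ⁻¹' {k})) :
    Continuous f := by
  refine continuous_iff_isClosed.2 fun s _ => ?_
  rw [← Set.biUnion_preimage_singleton]
  exact s.toFinite.isClosed_biUnion fun k _ => h k

/-- The number of zeros in the open unit disc. -/
noncomputable def innerCount {d : ℕ} (b : circleFree d) : Fin (d + 1) :=
  ⟨(innerRoots b.1).card, Nat.lt_succ_of_le (card_innerRoots_le b.1)⟩

theorem innerCount_eq_iff {d : ℕ} {k : Fin (d + 1)} {b : circleFree d} :
    innerCount b = k ↔ ∃ w : ℂ × (Fin k → ClosedDisc) × (Fin (d - k) → ClosedDisc),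
      rootCoeff d w = b.1 := by
  have hd : (k : ℕ) + (d - k) = d := Nat.add_sub_cancel' (Nat.le_of_lt_succ k.2)
  constructor
  · intro h
    exact exists_rootCoeff_eq hd b.2 (congrArg Fin.val h)
  · rintro ⟨w, hw⟩
    apply Fin.ext
    change (innerRoots b.1).card = k
    rw [← hw, innerRoots_rootCoeff hd (hw ▸ b.2)]
    simp

theorem continuous_innerCount (d : ℕ) : Continuous (innerCount : circleFree d → Fin (d + 1)) := by
  refine continuous_of_isClosed_fibres fun k => ?_
  have hd : (k : ℕ) + (d - k) = d := Nat.add_sub_cancel' (Nat.le_of_lt_succ k.2)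
  have h : (innerCount : circleFree d → Fin (d + 1)) ⁻¹' {k} = Subtype.val ⁻¹' Set.range
      (rootCoeff d : ℂ × (Fin k → ClosedDisc) × (Fin (d - k) → ClosedDisc) → _) := by
    ext b
    exact innerCount_eq_iff
  rw [h]
  exact (isProperMap_rootCoeff hd).isClosedMap.isClosed_range.preimage continuous_subtype_val

theorem continuous_scaleParam {k l : ℕ} : Continuous fun p : unitInterval ×
    (ℂ × (Fin k → ClosedDisc) × (Fin l → ClosedDisc)) => scaleParam p.1 p.2 := by
  unfold scaleParam
  refine (by fun_prop : Continuous _).prodMk (Continuous.prodMk (continuous_pi fun i => ?_)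
    (continuous_pi fun j => ?_))
  · exact continuous_scaleDisc.comp (continuous_fst.prodMk (by fun_prop))
  · exact continuous_scaleDisc.comp (continuous_fst.prodMk (by fun_prop))

theorem scaleParam_mem {d k l : ℕ} (hd : k + l = d) (t : unitInterval)
    {w : ℂ × (Fin k → ClosedDisc) × (Fin l → ClosedDisc)} (hw : rootCoeff d w ∈ circleFree d) :
    rootCoeff d (scaleParam t w) ∈ circleFree d := by
  rw [rootCoeff_mem_circleFree_iff hd] at hw ⊢
  exact ⟨hw.1, fun i => norm_scaleDisc_lt_one t (hw.2.1 i),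
    fun j => norm_scaleDisc_lt_one t (hw.2.2 j)⟩

/-- The monomial parameters. -/
noncomputable def monomialParam (k l : ℕ) (c : ℂ) :
    ℂ × (Fin k → ClosedDisc) × (Fin l → ClosedDisc) :=
  (c, fun _ => ⟨0, by simp⟩, fun _ => ⟨0, by simp⟩)

theorem monomialParam_mem {d k l : ℕ} (hd : k + l = d) {c : ℂ} (hc : c ≠ 0) :
    rootCoeff d (monomialParam k l c) ∈ circleFree d := by
  rw [rootCoeff_mem_circleFree_iff hd]
  simp [monomialParam, hc]

theorem scaleParam_zero {k l : ℕ} (w : ℂ × (Fin k → ClosedDisc) × (Fin l → ClosedDisc)) :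
    scaleParam 0 w = monomialParam k l w.1 := by
  simp [scaleParam, monomialParam, scaleDisc]

theorem scaleParam_one {k l : ℕ} (w : ℂ × (Fin k → ClosedDisc) × (Fin l → ClosedDisc)) :
    scaleParam 1 w = w := by
  simp [scaleParam, scaleDisc]

theorem nonempty_homotopyEquiv_innerCount_fibre {d : ℕ} (k : Fin (d + 1)) :
    Nonempty ({b : circleFree d // innerCount b = k} ≃ₕ PuncturedPlane) := by
  have hd : (k : ℕ) + (d - k) = d := Nat.add_sub_cancel' (Nat.le_of_lt_succ k.2)
  let r : ℂ × (Fin k → ClosedDisc) × (Fin (d - k) → ClosedDisc) → Fin (d + 1) → ℂ := rootCoeff d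
  let W := r ⁻¹' circleFree d
  let q' : W → circleFree d := (circleFree d).restrictPreimage r
  have hq' : IsProperMap q' := (isProperMap_rootCoeff hd).restrictPreimage _
  have hcount (w : W) : innerCount (q' w) = k := innerCount_eq_iff.2 ⟨w.1, rfl⟩
  let q (w : W) : {b : circleFree d // innerCount b = k} := ⟨q' w, hcount w⟩
  have hq : IsProperMap q :=
    isProperMap_of_comp_of_inj (hq'.continuous.subtype_mk _) continuous_subtype_val hq'
      Subtype.val_injective
  have hqe {w w' : W} (h : q w = q w') : r w.1 = r w'.1 :=
    congrArg (fun b => b.1.1) h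
  refine nonempty_homotopyEquiv_of_isProperMap hq ?_
    (⟨fun w => ⟨w.1.1, ((rootCoeff_mem_circleFree_iff hd).1 w.2).1⟩,
      Continuous.subtype_mk (by fun_prop) _⟩ : C(W, PuncturedPlane))
    ⟨fun c => ⟨monomialParam k (d - k) c.1, monomialParam_mem hd c.2⟩,
      Continuous.subtype_mk (by unfold monomialParam; fun_prop) _⟩ (fun x => rfl)
    ⟨fun p => ⟨scaleParam p.1 p.2.1, scaleParam_mem hd p.1 p.2.2⟩,
      Continuous.subtype_mk (continuous_scaleParam.comp
        (continuous_fst.prodMk (continuous_subtype_val.comp continuous_snd))) _⟩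
    (fun w => Subtype.ext (scaleParam_zero w.1)) (fun w => Subtype.ext (scaleParam_one w.1))
    (fun w w' h => Subtype.ext (rootCoeff_eq_rootCoeff hd w.2 (hqe h)).1)
    (fun w w' h t => Subtype.ext (Subtype.ext (rootCoeff_scaleParam_eq hd w.2 (hqe h) t)))
  rintro ⟨b, hb⟩
  obtain ⟨w, hw⟩ := innerCount_eq_iff.1 hb
  exact ⟨⟨w, by change rootCoeff d w ∈ circleFree d; rw [hw]; exact b.2⟩,
    Subtype.ext (Subtype.ext hw)⟩

end InnerCount

/-- for `d₁ ≥ d₂ ≥ 1` of the same parity, the space of non-resultant pairs of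
real binary forms of degrees `d₁, d₂` has exactly `d₂ + 1` connected components, and each
connected component has the integral cohomology of a circle (`ℤ` in degrees 0 and 1, trivial
in higher degrees). -/
theorem statement6 (d₁ d₂ : ℕ) (h21 : d₂ ≤ d₁) (h2 : 1 ≤ d₂) (hpar : d₁ % 2 = d₂ % 2) :
    Nonempty (ConnectedComponents (NonResultantPairs d₁ d₂) ≃ Fin (d₂ + 1)) ∧
    ∀ x : NonResultantPairs d₁ d₂,
      Nonempty (singularCohomology ℤ (TopCat.of (connectedComponent x)) 0 ≃ₗ[ℤ] ℤ) ∧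
      Nonempty (singularCohomology ℤ (TopCat.of (connectedComponent x)) 1 ≃ₗ[ℤ] ℤ) ∧
      ∀ i : ℕ, 2 ≤ i →
        Subsingleton (singularCohomology ℤ (TopCat.of (connectedComponent x)) i) := by
  obtain ⟨m, rfl⟩ : ∃ m, d₁ = d₂ + 2 * m := ⟨(d₁ - d₂) / 2, by omega⟩
  obtain ⟨e₀⟩ := NonResultantPairs.nonempty_homotopyEquiv d₂ m
  let e := e₀.trans (nonResultantPairsHomeomorph d₂).toHomotopyEquiv
  refine components_of_fibres ((continuous_innerCount d₂).comp e.toFun.continuous) fun k => ?_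
  obtain ⟨e₁⟩ := e.nonempty_fibre (continuous_innerCount d₂) k
  obtain ⟨e₂⟩ := nonempty_homotopyEquiv_innerCount_fibre k
  exact ⟨e₁.trans e₂⟩
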